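/- Let m > 1 and d > 1 be integers. There exist infinitely many (isomorphism classes of) number fields k of degree [k:ℚ] = d such that rank_m Cl(k) ≥ ⌊d/2⌋ + 1. -/

import Mathlib

open NumberField

/-- A relation `Γ ≤ ℤˢ × ℤʳ` whose fibre over `0` lies in `m ℤˢ` bounds the relations among
`s` elements of `A`, and so leaves `k ≤ s - r` independent elements of order `m`. -/
theorem exists_injective_of_relation {s r k : ℕ} (m : ℕ) (hk : k + r ≤ s)
    {A : Type*} [AddCommGroup A] (φ : (Fin s → ℤ) →+ A)
    (hm : ∀ x, (m : ℤ) • φ x = 0)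
    (Γ : Submodule ℤ ((Fin s → ℤ) × (Fin r → ℤ)))
    (hΓ : ∀ x, φ x = 0 → ∃ v, (x, v) ∈ Γ)
    (h0 : ∀ x, (x, 0) ∈ Γ → ∀ i, (m : ℤ) ∣ x i) :
    ∃ f : (Fin k → ZMod m) →+ A, Function.Injective f := by
  classical
  obtain ⟨n, bV⟩ := Submodule.basisOfPid (Pi.basisFun ℤ (Fin r))
    (Γ.map (LinearMap.snd ℤ (Fin s → ℤ) (Fin r → ℤ)))
  have hn : n ≤ r := by
    have h1 := Module.finrank_eq_card_basis bV
    have h2 := Submodule.finrank_le (Γ.map (LinearMap.snd ℤ (Fin s → ℤ) (Fin r → ℤ)))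
    simp only [Fintype.card_fin, Module.finrank_fin_fun] at h1 h2
    omega
  have hl : ∀ j : Fin n, ∃ x, (x, (bV j : Fin r → ℤ)) ∈ Γ := by
    intro j
    obtain ⟨⟨x, v⟩, hx, hv⟩ := (bV j).2
    exact ⟨x, by simpa [← hv] using hx⟩
  choose l hl using hl
  set L : Submodule ℤ (Fin s → ℤ) := Submodule.span ℤ (Set.range l) with hL
  obtain ⟨n', snf⟩ := Submodule.smithNormalForm (Pi.basisFun ℤ (Fin s)) L
  have hn' : n' ≤ n := by
    have h1 := Module.finrank_eq_card_basis snf.bN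
    have h2 := finrank_range_le_card (R := ℤ) l
    simp only [Fintype.card_fin] at h1 h2
    rw [Set.finrank, ← hL] at h2
    omega
  have hcard : Fintype.card (Fin k) ≤ Fintype.card {i : Fin s // i ∉ Set.range snf.f} := by
    have h1 : Fintype.card {i : Fin s // i ∈ Set.range snf.f} = n' := by
      exact (Fintype.card_congr (Equiv.ofInjective snf.f snf.f.injective)).symm.trans
        (Fintype.card_fin n')
    rw [Fintype.card_subtype_compl, h1]
    simp only [Fintype.card_fin]
    omega
  obtain ⟨e⟩ := Function.Embedding.nonempty_of_card_le hcard
  let g : Fin k → ZMod m →+ A := fun i =>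
    ZMod.lift m ⟨zmultiplesHom A (φ (snf.bM (e i))), by simpa using hm _⟩
  refine ⟨∑ i, (g i).comp (Pi.evalAddMonoidHom _ i), ?_⟩
  rw [injective_iff_map_eq_zero]
  intro z hz
  choose y hy using fun i => ZMod.intCast_surjective (z i)
  have hz' : φ (∑ i, y i • snf.bM (e i)) = 0 := by
    rw [← hz, AddMonoidHom.finsetSum_apply, map_sum]
    refine Finset.sum_congr rfl fun i _ => ?_
    simp only [AddMonoidHom.comp_apply, Pi.evalAddMonoidHom_apply, ← hy i, g, ZMod.lift_coe,
      zmultiplesHom_apply, map_zsmul]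
  obtain ⟨v, hv⟩ := hΓ _ hz'
  have hv' : v ∈ Γ.map (LinearMap.snd ℤ (Fin s → ℤ) (Fin r → ℤ)) := ⟨_, hv, rfl⟩
  have hrep := congrArg Subtype.val (bV.sum_repr ⟨v, hv'⟩)
  set c := bV.repr ⟨v, hv'⟩
  simp only [AddSubmonoidClass.coe_finsetSum, Submodule.coe_smul] at hrep
  have hdiff : ((∑ i, y i • snf.bM (e i)) - ∑ j, c j • l j, (0 : Fin r → ℤ)) ∈ Γ := by
    have := Γ.sub_mem hv (Γ.sum_mem fun j (_ : j ∈ Finset.univ) => Γ.smul_mem (c j) (hl j))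
    convert this using 1
    ext1
    · simp [Prod.fst_sum]
    · simp [-zsmul_eq_mul, Prod.snd_sum, hrep]
  have hdvd := h0 _ hdiff
  have hcoord : ∀ x : Fin s → ℤ, (∀ i, (m : ℤ) ∣ x i) → ∀ j, (m : ℤ) ∣ snf.bM.repr x j := by
    intro x hx j
    choose u hu using hx
    have : x = (m : ℤ) • u := by ext i; simp [hu]
    rw [this, map_smul]
    exact ⟨_, rfl⟩
  funext i
  have h2 := hcoord _ hdvd (e i)
  have h3 : snf.bM.repr (∑ j, c j • l j) (e i).1 = 0 :=
    snf.repr_eq_zero_of_notMem_range ⟨∑ j, c j • l j, L.sum_mem fun j _ =>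
      L.smul_mem _ (Submodule.subset_span ⟨j, rfl⟩)⟩ (e i).2
  have h4 : snf.bM.repr (∑ i, y i • snf.bM (e i)) (e i).1 = y i := by
    simp only [map_sum, map_smul, Module.Basis.repr_self, Finsupp.coe_finsetSum, Finset.sum_apply,
      Finsupp.smul_apply, smul_eq_mul]
    rw [Finset.sum_eq_single i]
    · simp
    · intro j _ hj
      rw [Finsupp.single_eq_of_ne fun h => hj (e.injective (Subtype.ext h)).symm, mul_zero]
    · simp
  rw [map_sub, Finsupp.sub_apply, h3, h4, sub_zero] at h2
  rw [← hy i, Pi.zero_apply]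
  exact (ZMod.intCast_zmod_eq_zero_iff_dvd _ _).2 h2

theorem ClassGroup.mk_eq_one_iff_mem_range {R K : Type*} [CommRing R] [IsDomain R] [Field K]
    [Algebra R K] [IsFractionRing R K] (I : (FractionalIdeal (nonZeroDivisors R) K)ˣ) :
    ClassGroup.mk K I = 1 ↔ ∃ x, toPrincipalIdeal R K x = I := by
  rw [ClassGroup.mk_eq_one_iff, FractionalIdeal.isPrincipal_iff, ← MonoidHom.mem_range,
    mem_principal_ideals_iff]
  simp only [eq_comm]

theorem exists_unit_of_toPrincipalIdeal_eq_one {R K : Type*} [CommRing R] [IsDomain R] [Field K]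
    [Algebra R K] [IsFractionRing R K] {x : Kˣ} (hx : toPrincipalIdeal R K x = 1) :
    ∃ u : Rˣ, Units.map (algebraMap R K).toMonoidHom u = x := by
  rw [toPrincipalIdeal_eq_iff, Units.val_one, ← FractionalIdeal.spanSingleton_one,
    FractionalIdeal.spanSingleton_eq_spanSingleton] at hx
  obtain ⟨u, hu⟩ := hx
  refine ⟨u⁻¹, ?_⟩
  rw [map_inv, inv_eq_iff_mul_eq_one]
  ext
  simpa [Units.smul_def, Algebra.smul_def] using hu

theorem exists_injective_classGroup {K : Type*} [Field K] [NumberField K] {s k m : ℕ}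
    (α : Fin s → Kˣ) (I : Fin s → (FractionalIdeal (nonZeroDivisors (𝓞 K)) K)ˣ)
    (hI : ∀ i, I i ^ m = toPrincipalIdeal (𝓞 K) K (α i))
    (hind : ∀ (n : Fin s → ℤ) (ζ β : Kˣ), IsOfFinOrder ζ → ∏ i, α i ^ n i = ζ * β ^ m →
      ∀ i, (m : ℤ) ∣ n i)
    (hk : k + Units.rank K ≤ s) :
    ∃ f : (Fin k → ZMod m) →+ Additive (ClassGroup (𝓞 K)), Function.Injective f := by
  let ι : (𝓞 K)ˣ →* Kˣ := Units.map (algebraMap (𝓞 K) K).toMonoidHom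
  let J : (Fin s → ℤ) → (FractionalIdeal (nonZeroDivisors (𝓞 K)) K)ˣ := fun n => ∏ i, I i ^ n i
  let A : (Fin s → ℤ) → Kˣ := fun n => ∏ i, α i ^ n i
  let E : (Fin (Units.rank K) → ℤ) → Kˣ := fun v => ∏ i, ι (Units.fundSystem K i) ^ v i
  have hJadd : ∀ a b, J (a + b) = J a * J b := fun a b => by
    simp [J, zpow_add, Finset.prod_mul_distrib]
  have hAadd : ∀ a b, A (a + b) = A a * A b := fun a b => by
    simp [A, zpow_add, Finset.prod_mul_distrib]
  have hEadd : ∀ a b, E (a + b) = E a * E b := fun a b => by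
    simp [E, zpow_add, Finset.prod_mul_distrib]
  have hAsmul : ∀ (c : ℤ) a, A (c • a) = A a ^ c := fun c a => by
    simp [A, -zsmul_eq_mul, ← Finset.prod_zpow, mul_comm c, zpow_mul]
  have hEsmul : ∀ (c : ℤ) a, E (c • a) = E a ^ c := fun c a => by
    simp [E, -zsmul_eq_mul, ← Finset.prod_zpow, mul_comm c, zpow_mul]
  have hA0 : A 0 = 1 := by simp [A]
  have hE0 : E 0 = 1 := by simp [E]
  have hJm : ∀ n, J n ^ m = toPrincipalIdeal (𝓞 K) K (A n) := fun n => by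
    simp only [J, A, map_prod, map_zpow, ← hI, ← Finset.prod_pow]
    exact Finset.prod_congr rfl fun i _ => by rw [← zpow_natCast, ← zpow_natCast, zpow_comm]
  let φ : (Fin s → ℤ) →+ Additive (ClassGroup (𝓞 K)) :=
    AddMonoidHom.mk' (fun n => Additive.ofMul (ClassGroup.mk K (J n))) fun a b => by
      rw [hJadd, map_mul, ofMul_mul]
  let Γ : Submodule ℤ ((Fin s → ℤ) × (Fin (Units.rank K) → ℤ)) :=
    { carrier := {z | ∃ ζ β : Kˣ, IsOfFinOrder ζ ∧ A z.1 = ζ * E z.2 * β ^ m}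
      zero_mem' := ⟨1, 1, IsOfFinOrder.one, by simp [hA0, hE0]⟩
      add_mem' := by
        rintro a b ⟨ζ, β, h1, h2⟩ ⟨ζ', β', h1', h2'⟩
        refine ⟨ζ * ζ', β * β', h1.mul h1', ?_⟩
        rw [Prod.fst_add, Prod.snd_add, hAadd, hEadd, h2, h2', mul_pow]
        simp only [mul_assoc, mul_left_comm]
      smul_mem' := by
        rintro c a ⟨ζ, β, h1, h2⟩
        refine ⟨ζ ^ c, β ^ c, h1.zpow, ?_⟩
        rw [Prod.smul_fst, Prod.smul_snd, hAsmul, hEsmul, h2, mul_zpow, mul_zpow]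
        congr 1
        rw [← zpow_natCast, ← zpow_natCast, zpow_comm] }
  refine exists_injective_of_relation m hk φ (fun x => ?_) Γ (fun x hx => ?_) (fun x hx => ?_)
  · have : (ClassGroup.mk K (J x)) ^ m = 1 := by
      rw [← map_pow, hJm, ClassGroup.mk_eq_one_iff_mem_range]
      exact ⟨_, rfl⟩
    simpa [φ, ← ofMul_pow] using congrArg Additive.ofMul this
  · have : ClassGroup.mk K (J x) = 1 := by simpa [φ] using hx
    rw [ClassGroup.mk_eq_one_iff_mem_range] at this
    obtain ⟨β, hβ⟩ := this
    have h1 : toPrincipalIdeal (𝓞 K) K (A x / β ^ m) = 1 := by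
      rw [map_div, ← hJm, map_pow, hβ, div_self']
    obtain ⟨u, hu⟩ := exists_unit_of_toPrincipalIdeal_eq_one h1
    obtain ⟨⟨ζ, v⟩, huv, -⟩ := Units.exist_unique_eq_mul_prod K u
    refine ⟨v, ι ζ, β, ?_, ?_⟩
    · exact ι.isOfFinOrder ((CommGroup.mem_torsion ζ.1).1 ζ.2)
    · have : A x = ι u * β ^ m := by rw [show ι u = _ from hu]; simp
      rw [this, huv]
      simp [E]
  · obtain ⟨ζ, β, h1, h2⟩ := hx
    exact hind x ζ β h1 (by simpa [hE0] using h2)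

section DedekindDomain

open IsDedekindDomain

variable {R : Type*} [CommRing R] [IsDedekindDomain R] {K : Type*} [Field K] [Algebra R K]
  [IsFractionRing R K]

theorem valuation_eq_exp_neg_count (v : HeightOneSpectrum R) {x : K} (hx : x ≠ 0) :
    v.valuation K x =
      WithZero.exp (-FractionalIdeal.count K v (FractionalIdeal.spanSingleton (nonZeroDivisors R) x)) := by
  classical
  have hR : ∀ r : R, r ≠ 0 → v.valuation K (algebraMap R K r) = WithZero.exp
      (-FractionalIdeal.count K v
        (FractionalIdeal.spanSingleton (nonZeroDivisors R) (algebraMap R K r))) := by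
    intro r hr
    rw [HeightOneSpectrum.valuation_of_algebraMap, HeightOneSpectrum.intValuation_if_neg v hr,
      ← FractionalIdeal.coeIdeal_span_singleton, FractionalIdeal.count_coe]
    simpa using hr
  obtain ⟨a, b, hb, rfl⟩ := IsFractionRing.div_surjective (A := R) x
  have hb0 : b ≠ 0 := nonZeroDivisors.ne_zero hb
  have ha0 : a ≠ 0 := by rintro rfl; simp at hx
  have hbK : algebraMap R K b ≠ 0 := by simpa using hb0
  have hmul := FractionalIdeal.count_mul K v
    (I := FractionalIdeal.spanSingleton (nonZeroDivisors R) (algebraMap R K a / algebraMap R K b))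
    (I' := FractionalIdeal.spanSingleton (nonZeroDivisors R) (algebraMap R K b))
    (FractionalIdeal.spanSingleton_ne_zero_iff.2 hx) (FractionalIdeal.spanSingleton_ne_zero_iff.2 hbK)
  rw [FractionalIdeal.spanSingleton_mul_spanSingleton, div_mul_cancel₀ _ hbK] at hmul
  rw [map_div₀, hR a ha0, hR b hb0, hmul, ← WithZero.exp_sub]
  congr 1
  ring

theorem exists_pow_eq_toPrincipalIdeal {m : ℕ} (hm : m ≠ 0) (x : Kˣ)
    (h : ∀ v : HeightOneSpectrum R, ∃ y : K, v.valuation K x = v.valuation K y ^ m) :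
    ∃ I : (FractionalIdeal (nonZeroDivisors R) K)ˣ, I ^ m = toPrincipalIdeal R K x := by
  classical
  set X : FractionalIdeal (nonZeroDivisors R) K := FractionalIdeal.spanSingleton _ (x : K) with hX
  have hX0 : X ≠ 0 := FractionalIdeal.spanSingleton_ne_zero_iff.2 x.ne_zero
  have hdvd : ∀ v : HeightOneSpectrum R, ∃ n : ℤ, FractionalIdeal.count K v X = n * m := by
    intro v
    obtain ⟨y, hy⟩ := h v
    have hy0 : y ≠ 0 := by
      rintro rfl
      simp [hm] at hy
    rw [valuation_eq_exp_neg_count v x.ne_zero, valuation_eq_exp_neg_count v hy0,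
      ← WithZero.exp_nsmul, WithZero.exp_inj] at hy
    refine ⟨FractionalIdeal.count K v (FractionalIdeal.spanSingleton _ y), ?_⟩
    simp at hy
    linarith
  choose n hn using hdvd
  have hfin : ∀ᶠ v : HeightOneSpectrum R in Filter.cofinite, n v = 0 := by
    filter_upwards [FractionalIdeal.finite_factors X] with v hv
    rw [hn] at hv
    simpa [hm] using hv
  have hsupp : (Function.mulSupport fun v : HeightOneSpectrum R =>
      (v.asIdeal : FractionalIdeal (nonZeroDivisors R) K) ^ n v).Finite := by
    refine Set.Finite.subset hfin fun v hv hv0 => hv ?_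
    change (v.asIdeal : FractionalIdeal (nonZeroDivisors R) K) ^ n v = 1
    rw [show n v = 0 from hv0, zpow_zero]
  have hpow : (∏ᶠ v : HeightOneSpectrum R,
      (v.asIdeal : FractionalIdeal (nonZeroDivisors R) K) ^ n v) ^ m = X := by
    rw [(finprod_pow hsupp m), ← FractionalIdeal.finprod_heightOneSpectrum_factorization' K hX0]
    refine finprod_congr fun v => ?_
    rw [hn, zpow_mul, zpow_natCast]
  have hne : (∏ᶠ v : HeightOneSpectrum R,
      (v.asIdeal : FractionalIdeal (nonZeroDivisors R) K) ^ n v) ≠ 0 := fun h0 => by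
    rw [h0, zero_pow hm] at hpow
    exact hX0 hpow.symm
  refine ⟨Units.mk0 _ hne, ?_⟩
  · ext1
    rw [Units.val_pow_eq_pow_val, Units.val_mk0, hpow, coe_toPrincipalIdeal]

end DedekindDomain

section Valuation

open Polynomial

variable {K Γ₀ : Type*} [Field K] [LinearOrderedCommGroupWithZero Γ₀] (v : Valuation K Γ₀)

theorem Valuation.map_intCast_le_one (n : ℤ) : v (n : K) ≤ 1 := by
  have h : (n : K) ∈ v.integer := intCast_mem _ n
  exact h

theorem Valuation.map_intCast_eq_one_of_isCoprime {a b : ℤ} (h : IsCoprime a b)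
    (ha : v (a : K) < 1) : v (b : K) = 1 := by
  obtain ⟨x, y, hxy⟩ := h
  refine le_antisymm (v.map_intCast_le_one b) (not_lt.1 fun hb => ?_)
  have h1 : v (((x * a + y * b : ℤ)) : K) < 1 := by
    push_cast
    refine v.map_add_lt ?_ ?_
    · rw [map_mul]
      exact mul_lt_one_of_nonneg_of_lt_one_right (v.map_intCast_le_one x) zero_le ha
    · rw [map_mul]
      exact mul_lt_one_of_nonneg_of_lt_one_right (v.map_intCast_le_one y) zero_le hb
  rw [hxy] at h1
  simp at h1

theorem Valuation.map_root_of_one_lt {N m : ℕ} {f : ℤ[X]} {c : ℤ} {θ : K}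
    (hN : 1 ≤ N) (hdeg : f.natDegree = N + 1) (hlc : f.leadingCoeff = c ^ m)
    (hc : IsCoprime c (f.coeff N)) (hθ : aeval θ f = 0) (h : 1 < v θ) :
    v θ = v ((c : K)⁻¹) ^ m := by
  have hlc' : f.coeff (N + 1) = c ^ m := by rw [← hdeg]; exact hlc
  have hθ0 : v θ ≠ 0 := (zero_lt_one.trans h).ne'
  rw [aeval_eq_sum_range, hdeg, Finset.sum_range_succ, Finset.sum_range_succ, hlc'] at hθ
  simp only [zsmul_eq_mul] at hθ
  have hsum : v (∑ i ∈ Finset.range N, (f.coeff i : K) * θ ^ i) ≤ v θ ^ (N - 1) := by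
    refine v.map_sum_le fun i hi => ?_
    rw [map_mul, map_pow]
    refine (mul_le_of_le_one_left' (v.map_intCast_le_one _)).trans ?_
    exact pow_le_pow_right₀ h.le (by have := Finset.mem_range.1 hi; omega)
  have hkey : ((c : K) ^ m * θ + (f.coeff N : K)) * θ ^ N =
      -∑ i ∈ Finset.range N, (f.coeff i : K) * θ ^ i := by
    push_cast at hθ
    linear_combination hθ
  have hlt : v ((c : K) ^ m * θ + (f.coeff N : K)) < 1 := by
    by_contra hge
    rw [not_lt] at hge
    have h2 := congrArg v hkey
    rw [map_mul, map_pow, Valuation.map_neg] at h2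
    have h3 : v θ ^ N ≤ v θ ^ (N - 1) :=
      (le_mul_of_one_le_left' hge).trans (h2.le.trans hsum)
    have h4 : v θ ^ (N - 1) < v θ ^ N := pow_lt_pow_right₀ h (by omega)
    exact absurd h3 (not_le.2 h4)
  have hc1 : v (c : K) < 1 := by
    refine lt_of_le_of_ne (v.map_intCast_le_one c) fun h1 => ?_
    have h2 : v ((c : K) ^ m * θ) = v θ := by simp [h1]
    have h3 := v.map_add_eq_of_lt_right (x := (f.coeff N : K)) (y := (c : K) ^ m * θ)
      (by rw [h2]; exact (v.map_intCast_le_one _).trans_lt h)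
    rw [add_comm, h2] at h3
    rw [h3] at hlt
    exact absurd hlt (not_lt.2 h.le)
  have hu := v.map_intCast_eq_one_of_isCoprime hc hc1
  have h5 : v ((c : K) ^ m * θ) = 1 := by
    have h6 := v.map_add_eq_of_lt_left (x := (f.coeff N : K))
      (y := -((c : K) ^ m * θ + (f.coeff N : K))) (by rw [Valuation.map_neg, hu]; exact hlt)
    rw [hu, show (f.coeff N : K) + -((c : K) ^ m * θ + (f.coeff N : K)) =
      -((c : K) ^ m * θ) by ring, Valuation.map_neg] at h6
    exact h6
  rw [map_mul, map_pow] at h5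
  rw [map_inv₀, inv_pow]
  exact eq_inv_of_mul_eq_one_right h5

theorem Valuation.map_root_sub_of_le_one {m : ℕ} {f : ℤ[X]} {a u : ℤ} {θ : K}
    (hu : f.eval a = u ^ m) (hcop : IsCoprime u (f.derivative.eval a)) (hθ : aeval θ f = 0)
    (h : v θ ≤ 1) : v (θ - a) = 1 ∨ v (θ - a) = v (u : K) ^ m := by
  have hle : v (θ - a) ≤ 1 := v.map_sub_le h (v.map_intCast_le_one a)
  rcases hle.eq_or_lt with h1 | hlt
  · exact Or.inl h1
  right
  let θ' : v.integer := ⟨θ, h⟩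
  let F : (v.integer)[X] := f.map (Int.castRingHom _)
  obtain ⟨k, hk⟩ := F.binomExpansion (a : v.integer) (θ' - a)
  have hF : F.eval θ' = 0 := by
    have : (algebraMap v.integer K) (F.eval θ') = 0 := by
      rw [eval_map, hom_eval₂, ← hθ, aeval_def]
      congr 1
    exact Subtype.ext this
  have hFa : F.eval (a : v.integer) = ((u ^ m : ℤ) : v.integer) := by
    rw [← hu]
    simp [F]
  have hF'a : F.derivative.eval (a : v.integer) = ((f.derivative.eval a : ℤ) : v.integer) := by
    simp [F, derivative_map]
  rw [add_sub_cancel, hF, hFa, hF'a] at hk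
  have hk' : (0 : K) = (u : K) ^ m + (f.derivative.eval a : ℤ) * (θ - a) + k * (θ - a) ^ 2 := by
    have := congrArg (algebraMap v.integer K) hk
    simpa [show algebraMap v.integer K θ' = θ from rfl,
      show algebraMap v.integer K k = k from rfl] using this
  have hkv : v (k : K) ≤ 1 := k.2
  have hprod : (u : K) ^ m = -((θ - a) * ((f.derivative.eval a : ℤ) + k * (θ - a))) := by
    linear_combination -hk'
  have hvprod := congrArg v hprod
  rw [Valuation.map_neg, map_mul, map_pow] at hvprod
  have hle2 : v (k * (θ - a)) < 1 := by
    rw [map_mul]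
    exact mul_lt_one_of_nonneg_of_lt_one_right hkv zero_le hlt
  have hu1 : v (u : K) < 1 := by
    refine lt_of_le_of_ne (v.map_intCast_le_one u) fun h1 => ?_
    rw [h1, one_pow] at hvprod
    have h3 : v (((f.derivative.eval a : ℤ) : K) + k * (θ - a)) ≤ 1 :=
      v.map_add_le (v.map_intCast_le_one _) hle2.le
    exact absurd hvprod (ne_of_gt (mul_lt_one_of_lt_of_le hlt h3))
  have hd := v.map_intCast_eq_one_of_isCoprime hcop hu1
  rw [v.map_add_eq_of_lt_left (by rw [hd]; exact hle2), hd, mul_one] at hvprod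
  exact hvprod.symm

theorem exists_pow_eq_toPrincipalIdeal_root_sub {R : Type*} [CommRing R] [IsDedekindDomain R]
    [Algebra R K] [IsFractionRing R K] {N m : ℕ} {f : ℤ[X]} {a u c : ℤ} {θ : K} (hm : m ≠ 0)
    (hN : 1 ≤ N) (hdeg : f.natDegree = N + 1) (hlc : f.leadingCoeff = c ^ m)
    (hc : IsCoprime c (f.coeff N)) (hu : f.eval a = u ^ m)
    (hcop : IsCoprime u (f.derivative.eval a)) (hθ : aeval θ f = 0)
    (x : Kˣ) (hx : (x : K) = θ - a) :
    ∃ I : (FractionalIdeal (nonZeroDivisors R) K)ˣ, I ^ m = toPrincipalIdeal R K x := by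
  refine exists_pow_eq_toPrincipalIdeal hm x fun w => ?_
  rw [hx]
  rcases le_or_gt (w.valuation K θ) 1 with h | h
  · rcases (w.valuation K).map_root_sub_of_le_one hu hcop hθ h with h1 | h1
    · exact ⟨1, by simpa using h1⟩
    · exact ⟨_, h1⟩
  · refine ⟨(c : K)⁻¹, ?_⟩
    rw [← (w.valuation K).map_root_of_one_lt hN hdeg hlc hc hθ h]
    exact Valuation.map_sub_eq_of_lt_left _ (((w.valuation K).map_intCast_le_one a).trans_lt h)

end Valuation

theorem IsOfFinOrder.pow_factorial_finrank_eq_one {K : Type*} [Field K] [NumberField K] {ζ : Kˣ}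
    (h : IsOfFinOrder ζ) : ζ ^ (2 * Module.finrank ℚ K).factorial = 1 := by
  refine orderOf_dvd_iff_pow_eq_one.1 ?_
  have hn : 0 < orderOf ζ := h.orderOf_pos
  rw [Nat.dvd_iff_prime_pow_dvd_dvd]
  intro p k hp hk
  rcases Nat.eq_zero_or_pos k with rfl | hk0
  · simp
  refine Nat.dvd_factorial (pow_pos hp.pos k) ?_
  obtain ⟨t, ht⟩ := hk
  have hprim : IsPrimitiveRoot ((ζ : K) ^ t) (p ^ k) := by
    have := (IsPrimitiveRoot.orderOf (ζ : K)).pow (n := orderOf (ζ : K)) (a := t) (b := p ^ k)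
      (by rwa [orderOf_units]) (by rw [orderOf_units, ht, mul_comm])
    exact this
  have : NeZero (p ^ k) := ⟨(pow_pos hp.pos k).ne'⟩
  have h1 := hprim.lcm_totient_le_finrank hprim
    (by rw [Nat.lcm_self]; exact Polynomial.cyclotomic.irreducible_rat (pow_pos hp.pos k))
  rw [Nat.lcm_self, Nat.totient_prime_pow hp hk0] at h1
  obtain ⟨j, rfl⟩ : ∃ j, k = j + 1 := ⟨k - 1, by omega⟩
  rw [Nat.add_sub_cancel] at h1
  have h2 := hp.two_le
  calc p ^ (j + 1) = p ^ j * p := pow_succ _ _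
    _ ≤ p ^ j * (2 * (p - 1)) := Nat.mul_le_mul_left _ (by omega)
    _ = 2 * (p ^ j * (p - 1)) := by ring
    _ ≤ _ := Nat.mul_le_mul_left _ h1

open Polynomial in
theorem rank_add_le_of_unique_real_root {K : Type*} [Field K] [NumberField K] {f : ℤ[X]} {θ : K}
    (hθ : aeval θ f = 0) (hgen : IntermediateField.adjoin ℚ {θ} = ⊤)
    (huniq : ∀ x y : ℝ, aeval x f = 0 → aeval y f = 0 → x = y) :
    Module.finrank ℚ K / 2 + 1 + Units.rank K ≤ Module.finrank ℚ K := by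
  classical
  have hreal : InfinitePlace.nrRealPlaces K ≤ 1 := by
    rw [← InfinitePlace.card_real_embeddings, Fintype.card_le_one_iff]
    rintro ⟨φ, hφ⟩ ⟨ψ, hψ⟩
    have hroot : ∀ (χ : K →+* ℂ) (hχ : ComplexEmbedding.IsReal χ), aeval (hχ.embedding θ) f = 0 := by
      intro χ hχ
      have := congrArg hχ.embedding hθ
      rwa [map_zero, ← RingHom.toIntAlgHom_apply, ← aeval_algHom_apply] at this
    have heq := huniq _ _ (hroot φ hφ) (hroot ψ hψ)
    have h2 : φ θ = ψ θ := by
      rw [← ComplexEmbedding.IsReal.coe_embedding_apply hφ,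
        ← ComplexEmbedding.IsReal.coe_embedding_apply hψ, heq]
    ext x
    have hx : x ∈ IntermediateField.adjoin ℚ {θ} := hgen ▸ IntermediateField.mem_top
    change φ x = ψ x
    induction hx using IntermediateField.adjoin_induction with
    | mem x hx => rw [Set.mem_singleton_iff.1 hx, h2]
    | algebraMap x => simp
    | add x y _ _ hx hy => rw [map_add, map_add, hx, hy]
    | inv x _ hx => rw [map_inv₀, map_inv₀, hx]
    | mul x y _ _ hx hy => rw [map_mul, map_mul, hx, hy]
  have h1 := InfinitePlace.card_add_two_mul_card_eq_rank K
  have h2 := InfinitePlace.card_eq_nrRealPlaces_add_nrComplexPlaces K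
  have h3 : 0 < Module.finrank ℚ K := Module.finrank_pos
  rw [Units.rank]
  omega

section Local

open Polynomial

theorem PadicInt.toZMod_eq_zero_iff_norm_lt_one {l : ℕ} [Fact l.Prime] (x : ℤ_[l]) :
    PadicInt.toZMod x = 0 ↔ ‖x‖ < 1 := by
  rw [← RingHom.mem_ker, PadicInt.ker_toZMod, IsLocalRing.mem_maximalIdeal, mem_nonunits_iff,
    PadicInt.not_isUnit_iff]

theorem exists_padicInt_root {l : ℕ} [Fact l.Prime] {f : ℤ[X]} {r : ℤ}
    (hr : ((f.eval r : ℤ) : ZMod l) = 0) (hr' : ((f.derivative.eval r : ℤ) : ZMod l) ≠ 0) :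
    ∃ ρ : ℤ_[l], aeval ρ f = 0 ∧ PadicInt.toZMod ρ = (r : ZMod l) := by
  have h1 : aeval (r : ℤ_[l]) f = ((f.eval r : ℤ) : ℤ_[l]) := by
    simpa using aeval_algebraMap_apply ℤ_[l] r f
  have h2 : aeval (r : ℤ_[l]) f.derivative = ((f.derivative.eval r : ℤ) : ℤ_[l]) := by
    simpa using aeval_algebraMap_apply ℤ_[l] r f.derivative
  have h3 : ‖aeval (r : ℤ_[l]) f‖ < 1 := by
    rw [← PadicInt.toZMod_eq_zero_iff_norm_lt_one, h1, map_intCast, hr]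
  have h4 : ‖aeval (r : ℤ_[l]) f.derivative‖ = 1 := by
    refine le_antisymm (PadicInt.norm_le_one _) (not_lt.1 fun h => hr' ?_)
    rwa [← PadicInt.toZMod_eq_zero_iff_norm_lt_one, h2, map_intCast] at h
  obtain ⟨ρ, hρ, hd, -⟩ := hensels_lemma (F := f) (a := (r : ℤ_[l])) (by rw [h4]; simpa using h3)
  refine ⟨ρ, hρ, ?_⟩
  rw [h4, ← PadicInt.toZMod_eq_zero_iff_norm_lt_one, map_sub, map_intCast, sub_eq_zero] at hd
  exact hd

theorem prod_zpow_pow_eq_one_of_eq_mul_pow {K : Type*} [Field K] {l p W : ℕ} [Fact l.Prime]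
    (hl : p * W ∣ l - 1) {f : ℤ[X]} {θ : K}
    (hlift : ∀ ρ : ℚ_[l], aeval ρ f = 0 → ∃ σ : K →+* ℚ_[l], σ θ = ρ) {r : ℤ}
    (hr : ((f.eval r : ℤ) : ZMod l) = 0) (hr' : ((f.derivative.eval r : ℤ) : ZMod l) ≠ 0)
    {ι : Type*} [Fintype ι] (a : ι → ℤ) (α : ι → Kˣ) (hα : ∀ i, (α i : K) = θ - a i)
    (x : ι → (ZMod l)ˣ) (hx : ∀ i, (x i : ZMod l) = r - a i) (n : ι → ℤ) {ζ β : Kˣ}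
    (hζ : ζ ^ W = 1) (h : ∏ i, α i ^ n i = ζ * β ^ p) :
    ∏ i, (x i ^ ((l - 1) / p)) ^ n i = 1 := by
  have hl1 : 0 < l - 1 := Nat.sub_pos_of_lt (Fact.out : l.Prime).one_lt
  have hpW : 0 < p * W := Nat.pos_of_dvd_of_pos hl hl1
  have hp : 0 < p := Nat.pos_of_mul_pos_right hpW
  have hW : 0 < W := Nat.pos_of_mul_pos_left hpW
  obtain ⟨ρ, hρ, hρr⟩ := exists_padicInt_root hr hr'
  obtain ⟨σ, hσ⟩ := hlift (ρ : ℚ_[l]) (by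
    have := congrArg (algebraMap ℤ_[l] ℚ_[l]) hρ
    rwa [map_zero, ← aeval_algebraMap_apply] at this)
  have hnorm : ∀ i, ‖ρ - (a i : ℤ_[l])‖ = 1 := by
    intro i
    refine le_antisymm (PadicInt.norm_le_one _) (not_lt.1 fun h => (x i).ne_zero ?_)
    rw [← PadicInt.toZMod_eq_zero_iff_norm_lt_one, map_sub, hρr, map_intCast] at h
    rw [hx i, h]
  let u : ι → ℤ_[l]ˣ := fun i => (PadicInt.isUnit_iff.2 (hnorm i)).unit
  have hu : ∀ i, Units.map (PadicInt.Coe.ringHom (p := l)).toMonoidHom (u i) =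
      Units.map σ.toMonoidHom (α i) := by
    intro i
    ext
    simp only [u, Units.coe_map, IsUnit.unit_spec, RingHom.toMonoidHom_eq_coe, MonoidHom.coe_coe,
      hα, map_sub, hσ, map_intCast]
    rfl
  have hunit : ∀ z : ℚ_[l]ˣ, ‖(z : ℚ_[l])‖ = 1 →
      ∃ w : ℤ_[l]ˣ, Units.map (PadicInt.Coe.ringHom (p := l)).toMonoidHom w = z := by
    intro z hz
    exact ⟨PadicInt.mkUnits hz, by ext; rfl⟩
  obtain ⟨z, hz⟩ := hunit (Units.map σ.toMonoidHom ζ) (by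
    have : ‖((Units.map σ.toMonoidHom ζ : ℚ_[l]ˣ) : ℚ_[l])‖ ^ W = 1 := by
      rw [← norm_pow, ← Units.val_pow_eq_pow_val, ← map_pow, hζ]
      simp
    exact (pow_eq_one_iff_of_nonneg (norm_nonneg _) hW.ne').1 this)
  have heq := congrArg (Units.map σ.toMonoidHom) h
  rw [map_prod, map_mul, map_pow, ← hz] at heq
  simp only [map_zpow, ← hu] at heq
  simp only [← map_zpow, ← map_prod] at heq
  obtain ⟨b, hb⟩ := hunit (Units.map σ.toMonoidHom β) (by
    have h1 : (Units.map σ.toMonoidHom β) ^ p =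
        Units.map (PadicInt.Coe.ringHom (p := l)).toMonoidHom (z⁻¹ * ∏ i, u i ^ n i) := by
      rw [map_mul, heq, map_inv, inv_mul_cancel_left]
    have : ‖((Units.map σ.toMonoidHom β : ℚ_[l]ˣ) : ℚ_[l])‖ ^ p = 1 := by
      rw [← norm_pow, ← Units.val_pow_eq_pow_val, h1]
      exact PadicInt.norm_units _
    exact (pow_eq_one_iff_of_nonneg (norm_nonneg _) hp.ne').1 this)
  rw [← hb, ← map_pow, ← map_mul] at heq
  have hinj : Function.Injective (Units.map (PadicInt.Coe.ringHom (p := l)).toMonoidHom) :=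
    Units.map_injective Subtype.val_injective
  have heq2 := congrArg (Units.map (PadicInt.toZMod (p := l)).toMonoidHom) (hinj heq)
  have hux : ∀ i, Units.map (PadicInt.toZMod (p := l)).toMonoidHom (u i) = x i := by
    intro i
    ext
    simp [u, hx, hρr]
  have hzW : z ^ W = 1 := hinj (by rw [map_pow, hz, ← map_pow, hζ, map_one, map_one])
  rw [map_prod, map_mul, map_pow] at heq2
  simp only [map_zpow, hux] at heq2
  obtain ⟨t, ht⟩ := hl
  have hdiv : (l - 1) / p = W * t := by
    rw [ht, mul_assoc, Nat.mul_div_cancel_left _ hp]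
  have hcard : ∀ y : (ZMod l)ˣ, y ^ (l - 1) = 1 := ZMod.units_pow_card_sub_one_eq_one l
  have heq3 := congrArg (· ^ ((l - 1) / p)) heq2
  simp only [mul_pow, ← Finset.prod_pow] at heq3
  rw [← pow_mul (Units.map _ b), hdiv, ← mul_assoc, ← ht, hcard, pow_mul, ← map_pow, hzW, map_one,
    one_pow, one_mul] at heq3
  rw [hdiv, ← heq3]
  refine Finset.prod_congr rfl fun i _ => ?_
  rw [← zpow_natCast, ← zpow_natCast, zpow_comm]

end Local

theorem dvd_exponents_of_prime_dvd {K : Type*} [Field K] {ι : Type*} [Fintype ι] {m : ℕ}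
    (hm : m ≠ 0) (α : ι → Kˣ)
    (hp : ∀ p : ℕ, p.Prime → p ∣ m → ∀ (n : ι → ℤ) (ζ β : Kˣ), IsOfFinOrder ζ →
      ∏ i, α i ^ n i = ζ * β ^ p → ∀ i, (p : ℤ) ∣ n i)
    (n : ι → ℤ) (ζ β : Kˣ) (hζ : IsOfFinOrder ζ) (h : ∏ i, α i ^ n i = ζ * β ^ m) (i : ι) :
    (m : ℤ) ∣ n i := by
  suffices H : ∀ t : ℕ, t ∣ m → ∀ (n : ι → ℤ) (ζ β : Kˣ), IsOfFinOrder ζ →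
      ∏ i, α i ^ n i = ζ * β ^ t → ∀ i, (t : ℤ) ∣ n i from H m dvd_rfl n ζ β hζ h i
  intro t
  induction t using induction_on_primes with
  | zero => exact fun h0 => absurd (zero_dvd_iff.1 h0) hm
  | one => simp
  | prime_mul p t hpp ih =>
    intro htm n ζ β hζ h i
    have h1 := hp p hpp (dvd_of_mul_right_dvd htm) n ζ (β ^ t) hζ
      (by rw [h, ← pow_mul, mul_comm t])
    choose n' hn' using h1
    have h3 : ((∏ i, α i ^ n' i) / β ^ t) ^ p = ζ := by
      rw [div_pow, ← pow_mul, div_eq_iff_eq_mul, mul_comm t, ← h, ← Finset.prod_pow]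
      refine Finset.prod_congr rfl fun j _ => ?_
      rw [hn' j, ← zpow_natCast, ← zpow_mul, mul_comm]
    have h4 : IsOfFinOrder ((∏ i, α i ^ n' i) / β ^ t) :=
      IsOfFinOrder.of_pow (by rwa [h3]) hpp.ne_zero
    have h5 := ih (dvd_of_mul_left_dvd htm) n' _ β h4 (div_mul_cancel _ _).symm i
    rw [hn' i]
    push_cast
    exact mul_dvd_mul_left _ h5

open Polynomial in
theorem exists_injective_classGroup_of_polynomial {K : Type*} [Field K] [NumberField K] {N m : ℕ}
    (hm : m ≠ 0) (hN : 1 ≤ N) {f : ℤ[X]} {θ : K} {c : ℤ} {a u : Fin (N + 1) → ℤ}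
    (hdeg : f.natDegree = N + 1) (hlc : f.leadingCoeff = c ^ m) (hc : IsCoprime c (f.coeff N))
    (hu : ∀ i, f.eval (a i) = u i ^ m) (hu0 : ∀ i, u i ≠ 0)
    (hcop : ∀ i, IsCoprime (u i) (f.derivative.eval (a i)))
    (hθ : aeval θ f = 0) (hgen : IntermediateField.adjoin ℚ {θ} = ⊤)
    (hrank : Module.finrank ℚ K = N + 1)
    (hlift : ∀ (l : ℕ) [Fact l.Prime] (ρ : ℚ_[l]), aeval ρ f = 0 → ∃ σ : K →+* ℚ_[l], σ θ = ρ)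
    (huniq : ∀ x y : ℝ, aeval x f = 0 → aeval y f = 0 → x = y)
    (hind : ∀ p : ℕ, p.Prime → p ∣ m → ∀ n : Fin (N + 1) → ℤ,
      (∀ (l : ℕ) [Fact l.Prime], p * (2 * (N + 1)).factorial ∣ l - 1 →
        ∀ (r : ℤ) (x : Fin (N + 1) → (ZMod l)ˣ), ((f.eval r : ℤ) : ZMod l) = 0 →
        ((f.derivative.eval r : ℤ) : ZMod l) ≠ 0 → (∀ i, (x i : ZMod l) = r - a i) →
        ∏ i, (x i ^ ((l - 1) / p)) ^ n i = 1) → ∀ i, (p : ℤ) ∣ n i) :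
    ∃ g : (Fin ((N + 1) / 2 + 1) → ZMod m) →+ Additive (ClassGroup (𝓞 K)),
      Function.Injective g := by
  have hne : ∀ i, θ - a i ≠ 0 := by
    intro i h0
    rw [sub_eq_zero] at h0
    have h1 : aeval (a i : K) f = ((f.eval (a i) : ℤ) : K) := by
      simpa using aeval_algebraMap_apply K (a i) f
    rw [← h0, hθ, hu] at h1
    exact pow_ne_zero m (hu0 i) (by exact_mod_cast h1.symm)
  let α : Fin (N + 1) → Kˣ := fun i => Units.mk0 _ (hne i)
  have hI : ∀ i, ∃ I : (FractionalIdeal (nonZeroDivisors (𝓞 K)) K)ˣ,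
      I ^ m = toPrincipalIdeal (𝓞 K) K (α i) := fun i =>
    exists_pow_eq_toPrincipalIdeal_root_sub hm hN hdeg hlc hc (hu i) (hcop i) hθ (α i) rfl
  choose I hI using hI
  refine exists_injective_classGroup α I hI (fun n ζ β hζ h => ?_) ?_
  · refine dvd_exponents_of_prime_dvd hm α (fun p hp hpm n ζ β hζ h => ?_) n ζ β hζ h
    refine hind p hp hpm n fun l _ hl r x hr hr' hx => ?_
    refine prod_zpow_pow_eq_one_of_eq_mul_pow hl (hlift l) hr hr' a α (fun _ => rfl) x hx n ?_ h
    rw [← hrank]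
    exact hζ.pow_factorial_finrank_eq_one
  · have := rank_add_le_of_unique_real_root hθ hgen huniq
    rwa [hrank] at this

section Family

open Polynomial

variable {R S : Type*} [CommRing R] [CommRing S]

/-- The number `M` with `w * M = (k * c + w * t) ^ m - (k * c) ^ m`. -/
def nakanoCoeff (m : ℕ) (w k t c : R) : R :=
  t * ∑ i ∈ Finset.range m, (k * c + w * t) ^ i * (k * c) ^ (m - 1 - i)

/-- The monic polynomial with roots `b j`. -/
noncomputable def rootsPoly {N : ℕ} (b : Fin N → R) : R[X] := ∏ j, (X - C (b j))

/-- The polynomial `c ^ m * (X * P + k ^ m) + M * P` with `P = ∏ (X - b j)`, where `M` is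
chosen such that the value at `0` is an `m`-th power. -/
noncomputable def nakanoPoly {N : ℕ} (m : ℕ) (b : Fin N → R) (k t c : R) : R[X] :=
  C (c ^ m) * (X * rootsPoly b + C (k ^ m)) +
    C (nakanoCoeff m (∏ j, -b j) k t c) * rootsPoly b

theorem mul_nakanoCoeff (m : ℕ) (w k t c : R) :
    w * nakanoCoeff m w k t c = (k * c + w * t) ^ m - (k * c) ^ m := by
  rw [nakanoCoeff, ← mul_assoc, ← (Commute.all (k * c + w * t) (k * c)).geom_sum₂_mul m]
  ring

theorem map_nakanoCoeff (g : R →+* S) (m : ℕ) (w k t c : R) :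
    g (nakanoCoeff m w k t c) = nakanoCoeff m (g w) (g k) (g t) (g c) := by
  simp [nakanoCoeff]

theorem nakanoCoeff_zero_left (m : ℕ) (k t c : R) :
    nakanoCoeff m 0 k t c = m * t * (k * c) ^ (m - 1) := by
  have h : ∀ i ∈ Finset.range m, (k * c + 0 * t) ^ i * (k * c) ^ (m - 1 - i) =
      (k * c) ^ (m - 1) := by
    intro i hi
    rw [zero_mul, add_zero, ← pow_add]
    congr 1
    have := Finset.mem_range.1 hi
    omega
  rw [nakanoCoeff, Finset.sum_congr rfl h]
  simp
  ring

theorem nakanoCoeff_zero_right {m : ℕ} (hm : m ≠ 0) (w k t : R) :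
    nakanoCoeff m w k t 0 = w ^ (m - 1) * t ^ m := by
  obtain ⟨n, rfl⟩ := Nat.exists_eq_succ_of_ne_zero hm
  rw [nakanoCoeff, Finset.sum_eq_single n]
  · simp
    ring
  · intro i hi hin
    have := Finset.mem_range.1 hi
    rw [mul_zero, zero_pow (by omega), mul_zero]
  · simp

variable {N : ℕ}

theorem map_rootsPoly (g : R →+* S) (b : Fin N → R) :
    (rootsPoly b).map g = rootsPoly (fun j => g (b j)) := by
  simp [rootsPoly, Polynomial.map_prod]

theorem map_nakanoPoly (g : R →+* S) (m : ℕ) (b : Fin N → R) (k t c : R) :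
    (nakanoPoly m b k t c).map g = nakanoPoly m (fun j => g (b j)) (g k) (g t) (g c) := by
  rw [nakanoPoly, nakanoPoly, Polynomial.map_add, Polynomial.map_mul, Polynomial.map_add,
    Polynomial.map_mul, Polynomial.map_mul, map_rootsPoly, map_X, Polynomial.map_C,
    Polynomial.map_C, Polynomial.map_C, map_nakanoCoeff, map_pow, map_pow, map_prod]
  simp only [map_neg, map_pow]

theorem rootsPoly_monic (b : Fin N → R) : (rootsPoly b).Monic :=
  monic_prod_X_sub_C _ _

theorem natDegree_rootsPoly [Nontrivial R] (b : Fin N → R) : (rootsPoly b).natDegree = N := by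
  rw [rootsPoly, natDegree_finsetProd_X_sub_C_eq_card]
  simp

theorem eval_rootsPoly (b : Fin N → R) (x : R) : (rootsPoly b).eval x = ∏ j, (x - b j) := by
  simp [rootsPoly, eval_prod]

theorem eval_rootsPoly_self (b : Fin N → R) (j : Fin N) : (rootsPoly b).eval (b j) = 0 := by
  rw [eval_rootsPoly]
  exact Finset.prod_eq_zero (Finset.mem_univ j) (sub_self _)

theorem eval_derivative_rootsPoly_self_ne_zero [IsDomain R] {b : Fin N → R}
    (hb : Function.Injective b) (j : Fin N) : (rootsPoly b).derivative.eval (b j) ≠ 0 := by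
  rw [rootsPoly, derivative_prod_finset, eval_finsetSum, Finset.sum_eq_single j]
  · simp only [derivative_sub, derivative_X, derivative_C, sub_zero, mul_one, eval_prod, eval_sub,
      eval_X, eval_C]
    refine Finset.prod_ne_zero_iff.2 fun i hi => sub_ne_zero.2 fun h => ?_
    exact (Finset.mem_erase.1 hi).1 (hb h).symm
  · intro i _ hij
    rw [eval_mul, eval_prod, Finset.prod_eq_zero (Finset.mem_erase.2 ⟨hij.symm, Finset.mem_univ j⟩),
      zero_mul]
    simp
  · simp

variable (m : ℕ) (b : Fin N → R) (k t c : R)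

theorem eval_nakanoPoly (x : R) : (nakanoPoly m b k t c).eval x =
    c ^ m * (x * (rootsPoly b).eval x + k ^ m) +
      nakanoCoeff m (∏ j, -b j) k t c * (rootsPoly b).eval x := by
  simp [nakanoPoly]

theorem eval_nakanoPoly_self (j : Fin N) : (nakanoPoly m b k t c).eval (b j) = (k * c) ^ m := by
  rw [eval_nakanoPoly, eval_rootsPoly_self]
  ring

theorem eval_nakanoPoly_zero :
    (nakanoPoly m b k t c).eval 0 = (k * c + (∏ j, -b j) * t) ^ m := by
  have h := mul_nakanoCoeff m (∏ j, -b j) k t c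
  rw [eval_nakanoPoly, eval_rootsPoly]
  simp only [zero_sub]
  linear_combination h

theorem eval_derivative_nakanoPoly (x : R) : (nakanoPoly m b k t c).derivative.eval x =
    c ^ m * ((rootsPoly b).eval x + x * (rootsPoly b).derivative.eval x) +
      nakanoCoeff m (∏ j, -b j) k t c * (rootsPoly b).derivative.eval x := by
  simp only [nakanoPoly, derivative_add, derivative_mul, derivative_C, derivative_X, eval_add,
    eval_mul, eval_C, eval_X, eval_zero, eval_one]
  ring

theorem natDegree_tail_nakanoPoly_lt [Nontrivial R] :
    (C (c ^ m) * C (k ^ m) + C (nakanoCoeff m (∏ j, -b j) k t c) * rootsPoly b).natDegree ≤ N := by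
  refine (natDegree_add_le _ _).trans (max_le ?_ ?_)
  · rw [← C_mul, natDegree_C]
    exact Nat.zero_le _
  · exact (natDegree_C_mul_le _ _).trans (natDegree_rootsPoly b).le

theorem coeff_succ_nakanoPoly [Nontrivial R] :
    (nakanoPoly m b k t c).coeff (N + 1) = c ^ m := by
  have hmon : (rootsPoly b).coeff N = 1 := by
    have := (rootsPoly_monic b).coeff_natDegree
    rwa [natDegree_rootsPoly] at this
  rw [nakanoPoly, mul_add, add_assoc, coeff_add, coeff_C_mul, coeff_X_mul, hmon,
    coeff_eq_zero_of_natDegree_lt (Nat.lt_succ_of_le (natDegree_tail_nakanoPoly_lt m b k t c))]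
  simp

theorem natDegree_nakanoPoly_le [Nontrivial R] : (nakanoPoly m b k t c).natDegree ≤ N + 1 := by
  rw [nakanoPoly, mul_add, add_assoc]
  refine (natDegree_add_le _ _).trans (max_le ?_
    ((natDegree_tail_nakanoPoly_lt m b k t c).trans (Nat.le_succ N)))
  refine (natDegree_C_mul_le _ _).trans ((natDegree_mul_le).trans ?_)
  rw [natDegree_rootsPoly, natDegree_X, add_comm]

variable {c} in
theorem natDegree_nakanoPoly [IsDomain R] (hc : c ≠ 0) :
    (nakanoPoly m b k t c).natDegree = N + 1 := by
  refine le_antisymm (natDegree_nakanoPoly_le m b k t c) (le_natDegree_of_ne_zero ?_)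
  rw [coeff_succ_nakanoPoly]
  exact pow_ne_zero m hc

variable {c} in
theorem leadingCoeff_nakanoPoly [IsDomain R] (hc : c ≠ 0) :
    (nakanoPoly m b k t c).leadingCoeff = c ^ m := by
  rw [leadingCoeff, natDegree_nakanoPoly m b k t hc, coeff_succ_nakanoPoly]

theorem coeff_nakanoPoly [Nontrivial R] : ∃ z, (nakanoPoly m b k t c).coeff N =
    c ^ m * z + nakanoCoeff m (∏ j, -b j) k t c := by
  have hmon : (rootsPoly b).coeff N = 1 := by
    have := (rootsPoly_monic b).coeff_natDegree
    rwa [natDegree_rootsPoly] at this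
  refine ⟨(X * rootsPoly b + C (k ^ m)).coeff N, ?_⟩
  rw [nakanoPoly, coeff_add, coeff_C_mul, coeff_C_mul, hmon, mul_one]

end Family

theorem eq_of_prod_sub_eq_neg {ι : Type*} [Fintype ι] [Nonempty ι] {s : ι → ℝ} {B κ x y : ℝ}
    (hs : ∀ i, |s i| ≤ B) (hκ : (3 * B) ^ Fintype.card ι < κ) (hx : ∏ i, (x - s i) = -κ)
    (hy : ∏ i, (y - s i) = -κ) : x = y := by
  have hB : 0 ≤ B := (abs_nonneg _).trans (hs (Classical.arbitrary ι))
  have hκ0 : 0 < κ := lt_of_le_of_lt (by positivity) hκ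
  have hsmall : ∀ z : ℝ, ∏ i, (z - s i) = -κ → z < -(2 * B) := by
    intro z hz
    by_contra! hlt
    rcases le_or_gt z (2 * B) with h | h
    · have h1 : |∏ i, (z - s i)| ≤ (3 * B) ^ Fintype.card ι := by
        rw [Finset.abs_prod, ← Finset.card_univ, ← Finset.prod_const]
        refine Finset.prod_le_prod (fun _ _ => abs_nonneg _) fun i _ => ?_
        rw [abs_le]
        have := abs_le.1 (hs i)
        constructor <;> linarith
      rw [hz, abs_neg, abs_of_pos hκ0] at h1
      linarith
    · have h1 : 0 ≤ ∏ i, (z - s i) := Finset.prod_nonneg fun i _ => by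
        have := abs_le.1 (hs i)
        linarith
      linarith
  have hmono : ∀ z z' : ℝ, ∏ i, (z - s i) = -κ → ∏ i, (z' - s i) = -κ → ¬ z < z' := by
    intro z z' hz hz' hlt
    have h1 := hsmall z hz
    have h2 := hsmall z' hz'
    have h3 : |∏ i, (z' - s i)| < |∏ i, (z - s i)| := by
      rw [Finset.abs_prod, Finset.abs_prod]
      refine Finset.prod_lt_prod_of_nonempty (fun i _ => ?_) (fun i _ => ?_) Finset.univ_nonempty
      · have := abs_le.1 (hs i)
        exact abs_pos.2 (by linarith)
      · have := abs_le.1 (hs i)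
        rw [abs_of_nonpos (by linarith), abs_of_nonpos (by linarith)]
        linarith
    rw [hz, hz'] at h3
    exact lt_irrefl _ h3
  exact le_antisymm (not_lt.1 (hmono y x hy hx)) (not_lt.1 (hmono x y hx hy))

section Arithmetic

open Polynomial

variable {N m : ℕ} {b : Fin N → ℤ}

theorem not_dvd_nakanoCoeff {w k t c : ℤ} (hm : m ≠ 0) (hc : Prime c) (hw : ¬ c ∣ w)
    (ht : ¬ c ∣ t) : ¬ c ∣ nakanoCoeff m w k t c := by
  rw [← Ideal.mem_span_singleton, ← Ideal.Quotient.eq_zero_iff_mem, map_nakanoCoeff,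
    Ideal.Quotient.eq_zero_iff_mem.2 (Ideal.mem_span_singleton_self c), nakanoCoeff_zero_right hm,
    ← map_pow, ← map_pow, ← map_mul, Ideal.Quotient.eq_zero_iff_mem, Ideal.mem_span_singleton]
  intro h
  rcases hc.dvd_or_dvd h with h | h
  · exact hw (hc.dvd_of_dvd_pow h)
  · exact ht (hc.dvd_of_dvd_pow h)

theorem isCoprime_coeff_nakanoPoly {k t c : ℤ} (hm : m ≠ 0) (hc : Prime c)
    (hw : ¬ c ∣ ∏ j, -b j) (ht : ¬ c ∣ t) : IsCoprime c ((nakanoPoly m b k t c).coeff N) := by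
  obtain ⟨z, hz⟩ := coeff_nakanoPoly m b k t c
  rw [hc.irreducible.coprime_iff_not_dvd, hz,
    dvd_add_right (dvd_mul_of_dvd_left (dvd_pow_self c hm) z)]
  exact not_dvd_nakanoCoeff hm hc hw ht

theorem isCoprime_eval_derivative_nakanoPoly {k t c : ℤ} (hm : m ≠ 0) (hc : Prime c)
    (hk : Prime k) (hw : ¬ c ∣ ∏ j, -b j) (ht : ¬ c ∣ t) (hkt : k ∣ t) (hkc : ¬ k ∣ c) (j : Fin N)
    (hkb : ¬ k ∣ b j) (hcP : ¬ c ∣ (rootsPoly b).derivative.eval (b j))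
    (hkP : ¬ k ∣ (rootsPoly b).derivative.eval (b j)) :
    IsCoprime (k * c) ((nakanoPoly m b k t c).derivative.eval (b j)) := by
  have hM : k ∣ nakanoCoeff m (∏ j, -b j) k t c := dvd_mul_of_dvd_left hkt _
  have hf : (nakanoPoly m b k t c).derivative.eval (b j) =
      (c ^ m * b j + nakanoCoeff m (∏ j, -b j) k t c) * (rootsPoly b).derivative.eval (b j) := by
    rw [eval_derivative_nakanoPoly, eval_rootsPoly_self]
    ring
  rw [hf]
  refine IsCoprime.mul_left ?_ ?_
  · rw [hk.irreducible.coprime_iff_not_dvd]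
    intro h
    rcases hk.dvd_or_dvd h with h | h
    · rw [dvd_add_left hM] at h
      rcases hk.dvd_or_dvd h with h | h
      · exact hkc (hk.dvd_of_dvd_pow h)
      · exact hkb h
    · exact hkP h
  · rw [hc.irreducible.coprime_iff_not_dvd]
    intro h
    rcases hc.dvd_or_dvd h with h | h
    · rw [dvd_add_right (dvd_mul_of_dvd_left (dvd_pow_self c hm) _)] at h
      exact not_dvd_nakanoCoeff hm hc hw ht h
    · exact hcP h

theorem isCoprime_eval_zero_derivative_nakanoPoly {k t c : ℤ} (hm : m ≠ 0) (hc : Prime c)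
    (hw : ¬ c ∣ ∏ j, -b j) (ht : ¬ c ∣ t)
    (hV : ∀ p : ℤ, Prime p → p ∣ k * c + (∏ j, -b j) * t →
      ¬ p ∣ (∏ j, -b j) ^ 2 - k ^ m * (rootsPoly b).derivative.eval 0) :
    IsCoprime (k * c + (∏ j, -b j) * t) ((nakanoPoly m b k t c).derivative.eval 0) := by
  have hce : ¬ c ∣ k * c + (∏ j, -b j) * t := by
    rw [dvd_add_right (dvd_mul_left c k)]
    exact fun h => (hc.dvd_or_dvd h).elim hw ht
  refine isCoprime_of_prime_dvd ?_ fun p hp hpe hpf => ?_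
  · rintro ⟨h, -⟩
    exact hce (h ▸ dvd_zero c)
  have hpc : ¬ p ∣ c := fun h =>
    hce ((hp.associated_of_dvd hc h).symm.dvd.trans hpe)
  have hMw := mul_nakanoCoeff m (∏ j, -b j) k t c
  have hwf : (∏ j, -b j) * (nakanoPoly m b k t c).derivative.eval 0 =
      c ^ m * ((∏ j, -b j) ^ 2 - k ^ m * (rootsPoly b).derivative.eval 0) +
        (k * c + (∏ j, -b j) * t) ^ m * (rootsPoly b).derivative.eval 0 := by
    rw [eval_derivative_nakanoPoly, eval_rootsPoly]
    simp only [zero_sub]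
    linear_combination (rootsPoly b).derivative.eval 0 * hMw
  have h1 : p ∣ c ^ m * ((∏ j, -b j) ^ 2 - k ^ m * (rootsPoly b).derivative.eval 0) := by
    rw [← dvd_add_left (dvd_mul_of_dvd_left (dvd_pow hpe hm) _), ← hwf]
    exact dvd_mul_of_dvd_right hpf _
  rcases hp.dvd_or_dvd h1 with h | h
  · exact hpc (hp.dvd_of_dvd_pow h)
  · exact hV p hp hpe h

theorem abs_nakanoCoeff_le {w k t c : ℤ} (hm : m ≠ 0) (hk : 0 < k) (hc : 0 < c)
    (hwt : |w * t| ≤ k * c) (ht : |t| * (m * (2 * k) ^ (m - 1)) ≤ c) :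
    |nakanoCoeff m w k t c| ≤ c ^ m := by
  have hkc : 0 < k * c := mul_pos hk hc
  have hterm : ∀ i ∈ Finset.range m,
      |(k * c + w * t) ^ i * (k * c) ^ (m - 1 - i)| ≤ (2 * (k * c)) ^ (m - 1) := by
    intro i hi
    have hi' := Finset.mem_range.1 hi
    rw [abs_mul, abs_pow, abs_pow, abs_of_pos hkc]
    calc |k * c + w * t| ^ i * (k * c) ^ (m - 1 - i)
        ≤ (2 * (k * c)) ^ i * (2 * (k * c)) ^ (m - 1 - i) := by
          have h1 : |k * c + w * t| ≤ 2 * (k * c) := by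
            refine (abs_add_le _ _).trans ?_
            rw [abs_of_pos hkc]
            linarith
          have h2 : k * c ≤ 2 * (k * c) := by linarith
          exact mul_le_mul (pow_le_pow_left₀ (abs_nonneg _) h1 _)
            (pow_le_pow_left₀ hkc.le h2 _) (by positivity) (by positivity)
      _ = (2 * (k * c)) ^ (m - 1) := by
          rw [← pow_add]
          congr 1
          omega
  have hsum : |∑ i ∈ Finset.range m, (k * c + w * t) ^ i * (k * c) ^ (m - 1 - i)| ≤
      m * (2 * (k * c)) ^ (m - 1) := by
    refine (Finset.abs_sum_le_sum_abs _ _).trans ((Finset.sum_le_sum hterm).trans ?_)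
    simp
  obtain ⟨n, rfl⟩ := Nat.exists_eq_succ_of_ne_zero hm
  rw [nakanoCoeff, abs_mul]
  rw [Nat.succ_eq_add_one, Nat.add_sub_cancel] at *
  calc |t| * |∑ i ∈ Finset.range (n + 1), (k * c + w * t) ^ i * (k * c) ^ (n - i)|
      ≤ |t| * ((n + 1 : ℕ) * (2 * (k * c)) ^ n) := by gcongr
    _ = (|t| * ((n + 1 : ℕ) * (2 * k) ^ n)) * c ^ n := by
        rw [← mul_assoc 2 k c, mul_pow (2 * k) c]
        ring
    _ ≤ c * c ^ n := by gcongr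
    _ = c ^ (n + 1) := by ring

theorem nakanoPoly_real_root_unique {k t c B : ℤ} (hm : m ≠ 0) (hc : 0 < c) (hB : 1 ≤ B)
    (hb : ∀ j, |b j| ≤ B) (hM : |nakanoCoeff m (∏ j, -b j) k t c| ≤ c ^ m)
    (hk : (3 * B) ^ (N + 1) < k) (x y : ℝ) (hx : aeval x (nakanoPoly m b k t c) = 0)
    (hy : aeval y (nakanoPoly m b k t c) = 0) : x = y := by
  set M := nakanoCoeff m (∏ j, -b j) k t c with hMdef
  have hcR : (0 : ℝ) < (c : ℝ) ^ m := by positivity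
  let s : Fin (N + 1) → ℝ := Fin.cons (-((M : ℝ) / (c : ℝ) ^ m)) fun j => (b j : ℝ)
  have hs : ∀ i, |s i| ≤ (B : ℝ) := by
    intro i
    refine Fin.cases ?_ (fun j => ?_) i
    · have h1 : |(M : ℝ)| ≤ (c : ℝ) ^ m := by exact_mod_cast hM
      have h2 : (1 : ℝ) ≤ B := by exact_mod_cast hB
      simp only [s, Fin.cons_zero, abs_neg, abs_div, abs_of_pos hcR]
      exact ((div_le_one hcR).2 h1).trans h2
    · simp only [s, Fin.cons_succ]
      exact_mod_cast hb j
  have hkpos : 1 ≤ k := by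
    have : 0 < (3 * B) ^ (N + 1) := by positivity
    linarith
  have hκ : (3 * (B : ℝ)) ^ Fintype.card (Fin (N + 1)) < (k : ℝ) ^ m := by
    rw [Fintype.card_fin]
    have h1 : (3 * B) ^ (N + 1) < k ^ m := hk.trans_le (le_self_pow₀ hkpos hm)
    exact_mod_cast h1
  have hroot : ∀ z : ℝ, aeval z (nakanoPoly m b k t c) = 0 →
      ∏ i, (z - s i) = -(k : ℝ) ^ m := by
    intro z hz
    have h1 : aeval z (nakanoPoly m b k t c) =
        ((nakanoPoly m b k t c).map (Int.castRingHom ℝ)).eval z := by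
      rw [eval_map, aeval_def]
      rfl
    rw [h1, map_nakanoPoly, eval_nakanoPoly, eval_rootsPoly] at hz
    have h2 : nakanoCoeff m (∏ j, -(Int.castRingHom ℝ) (b j)) (Int.castRingHom ℝ k)
        (Int.castRingHom ℝ t) (Int.castRingHom ℝ c) = (M : ℝ) := by
      have h3 := map_nakanoCoeff (Int.castRingHom ℝ) m (∏ j, -b j) k t c
      rw [map_prod] at h3
      simp only [map_neg] at h3
      exact h3.symm
    rw [h2] at hz
    simp only [Int.coe_castRingHom] at hz
    rw [Fin.prod_univ_succ]
    simp only [s, Fin.cons_zero, Fin.cons_succ]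
    field_simp
    linear_combination hz
  exact eq_of_prod_sub_eq_neg hs hκ (hroot x hx) (hroot y hy)

end Arithmetic

section GlobalData

open Polynomial

theorem not_natCast_dvd_of_natAbs_lt {a : ℤ} {n : ℕ} (ha : a ≠ 0) (h : a.natAbs < n) :
    ¬ (n : ℤ) ∣ a := fun hd =>
  Nat.not_dvd_of_pos_of_lt (Int.natAbs_pos.2 ha) h (Int.natCast_dvd.1 hd)

theorem exists_natCast_eq_of_injective (L : ℕ) [NeZero L] {N : ℕ} (b₀ : Fin N → ZMod L) :
    ∃ b : Fin N → ℤ, (∀ j, (b j : ZMod L) = b₀ j) ∧ Function.Injective b ∧ ∀ j, b j ≠ 0 := by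
  have hL : 0 < L := NeZero.pos L
  have hlt : ∀ j, (b₀ j).val < L := fun j => ZMod.val_lt _
  have hdiv : ∀ j, ((b₀ j).val + L * (j + 1)) / L = j + 1 := fun j => by
    rw [Nat.add_mul_div_left _ _ hL, Nat.div_eq_of_lt (hlt j), zero_add]
  refine ⟨fun j => (((b₀ j).val + L * (j + 1) : ℕ) : ℤ), fun j => ?_, fun i j h => ?_, fun j => ?_⟩
  · push_cast
    simp
  · have h' := Nat.cast_injective (R := ℤ) h
    have := congrArg (· / L) h'
    simp only [hdiv] at this
    exact Fin.ext (by omega)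
  · have : 0 < L * (j + 1 : ℕ) := by positivity
    have h2 : 0 < (b₀ j).val + L * (j + 1 : ℕ) := by omega
    exact Nat.cast_ne_zero.2 h2.ne'

theorem exists_nakanoPoly_of_residues {N m L : ℕ} [NeZero L] (hm : m ≠ 0)
    (b₀ : Fin N → ZMod L) (k₀ t₀ : ZMod L) (hk₀ : IsUnit k₀)
    (hV : ∀ (b : Fin N → ℤ) (k t c : ℤ), (∀ j, (b j : ZMod L) = b₀ j) → (k : ZMod L) = k₀ →
      (t : ZMod L) = t₀ → (c : ZMod L) = 1 → ∀ p : ℕ, p.Prime → p ∣ L →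
      (p : ℤ) ∣ k * c + (∏ j, -b j) * t →
      ¬ (p : ℤ) ∣ (∏ j, -b j) ^ 2 - k ^ m * (rootsPoly b).derivative.eval 0) :
    ∃ (b : Fin N → ℤ) (k t c : ℤ), (∀ j, (b j : ZMod L) = b₀ j) ∧ (k : ZMod L) = k₀ ∧
      (t : ZMod L) = t₀ ∧ (c : ZMod L) = 1 ∧ Prime c ∧ k * c ≠ 0 ∧
      k * c + (∏ j, -b j) * t ≠ 0 ∧ ¬ c ∣ k * c + (∏ j, -b j) * t ∧
      IsCoprime c ((nakanoPoly m b k t c).coeff N) ∧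
      (∀ j, IsCoprime (k * c) ((nakanoPoly m b k t c).derivative.eval (b j))) ∧
      IsCoprime (k * c + (∏ j, -b j) * t) ((nakanoPoly m b k t c).derivative.eval 0) ∧
      ∀ x y : ℝ, aeval x (nakanoPoly m b k t c) = 0 → aeval y (nakanoPoly m b k t c) = 0 →
        x = y := by
  obtain ⟨b, hb₀, hbinj, hb0⟩ := exists_natCast_eq_of_injective L b₀
  set w : ℤ := ∏ j, -b j with hw
  have hw0 : w ≠ 0 := Finset.prod_ne_zero_iff.2 fun j _ => neg_ne_zero.2 (hb0 j)
  set P' : Fin N → ℤ := fun j => (rootsPoly b).derivative.eval (b j) with hP'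
  have hP'0 : ∀ j, P' j ≠ 0 := eval_derivative_rootsPoly_self_ne_zero hbinj
  have hle : ∀ (F : Fin N → ℤ) j, (F j).natAbs ≤ ∑ i, (F i).natAbs := fun F j =>
    Finset.single_le_sum (f := fun i => (F i).natAbs) (fun _ _ => Nat.zero_le _)
      (Finset.mem_univ j)
  set B : ℕ := 1 + ∑ j, (b j).natAbs with hBdef
  obtain ⟨k, hklt, hkp, hkk₀⟩ := Nat.forall_exists_prime_gt_and_eq_mod hk₀
    (L + w.natAbs + ∑ j, (b j).natAbs + ∑ j, (P' j).natAbs + (3 * B) ^ (N + 1))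
  have hkpZ : Prime (k : ℤ) := Nat.prime_iff_prime_int.1 hkp
  have hkw : ¬ (k : ℤ) ∣ w := not_natCast_dvd_of_natAbs_lt hw0 (by omega)
  have hkb : ∀ j, ¬ (k : ℤ) ∣ b j := fun j =>
    not_natCast_dvd_of_natAbs_lt (hb0 j) (by have := hle b j; omega)
  have hkP : ∀ j, ¬ (k : ℤ) ∣ P' j := fun j =>
    not_natCast_dvd_of_natAbs_lt (hP'0 j) (by have := hle P' j; omega)
  set V : ℤ := w ^ 2 - k ^ m * (rootsPoly b).derivative.eval 0 with hVdef
  have hkV : ¬ (k : ℤ) ∣ V := by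
    rw [hVdef, dvd_sub_left (dvd_mul_of_dvd_left (dvd_pow_self _ hm) _)]
    exact fun h => hkw (hkpZ.dvd_of_dvd_pow h)
  have hV0 : V ≠ 0 := fun h => hkV (h ▸ dvd_zero _)
  set D : ℕ := ∏ p ∈ V.natAbs.primeFactors with ¬ p ∣ L, p with hD
  have hDL : D.Coprime L := Nat.Coprime.prod_left fun p hp => by
    rw [Finset.mem_filter] at hp
    exact (Nat.Prime.coprime_iff_not_dvd (Nat.prime_of_mem_primeFactors hp.1)).2 hp.2
  have hD0 : 0 < D := Finset.prod_pos fun p hp =>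
    (Nat.prime_of_mem_primeFactors (Finset.mem_filter.1 hp).1).pos
  have hDu : IsUnit (D : ZMod L) := (ZMod.isUnit_iff_coprime D L).2 hDL
  set s : ℕ := (t₀ * (k₀ * D)⁻¹).val + L with hs
  have hs0 : 0 < s := by have := NeZero.pos L; omega
  have ht₀ : ((k * D * s : ℕ) : ZMod L) = t₀ := by
    push_cast
    rw [hkk₀, hs]
    push_cast
    rw [ZMod.natCast_val, ZMod.cast_id, ZMod.natCast_self, add_zero, mul_comm t₀, ← mul_assoc,
      ZMod.mul_inv_of_unit _ (hk₀.mul hDu), one_mul]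
  set t : ℕ := k * D * s with ht
  have ht0 : 0 < t := by have := hkp.pos; positivity
  obtain ⟨c, hclt, hcp, hc₁⟩ := Nat.forall_exists_prime_gt_and_eq_mod (isUnit_one (M := ZMod L))
    (w.natAbs + t + V.natAbs + k + (w * t).natAbs + ∑ j, (P' j).natAbs +
      t * (m * (2 * k) ^ (m - 1)))
  have hcpZ : Prime (c : ℤ) := Nat.prime_iff_prime_int.1 hcp
  have hcw : ¬ (c : ℤ) ∣ w := not_natCast_dvd_of_natAbs_lt hw0 (by omega)
  have hct : ¬ (c : ℤ) ∣ t :=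
    not_natCast_dvd_of_natAbs_lt (by exact_mod_cast ht0.ne') (by rw [Int.natAbs_natCast]; omega)
  have hcV : ¬ (c : ℤ) ∣ V := not_natCast_dvd_of_natAbs_lt hV0 (by omega)
  have hcP : ∀ j, ¬ (c : ℤ) ∣ P' j := fun j =>
    not_natCast_dvd_of_natAbs_lt (hP'0 j) (by have := hle P' j; omega)
  have hkc : ¬ (k : ℤ) ∣ c := fun h => by
    have := (Nat.prime_dvd_prime_iff_eq hkp hcp).1 (Int.natCast_dvd_natCast.1 h)
    omega
  have hkt : (k : ℤ) ∣ t := Int.natCast_dvd_natCast.2 ⟨D * s, by rw [ht, mul_assoc]⟩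
  have hce : ¬ (c : ℤ) ∣ k * c + w * t := by
    rw [dvd_add_right (dvd_mul_left _ _)]
    exact fun h => (hcpZ.dvd_or_dvd h).elim hcw hct
  have hB1 : (1 : ℤ) ≤ B := by omega
  have hk1 : (0 : ℤ) < k := by exact_mod_cast hkp.pos
  have hc1 : (0 : ℤ) < c := by exact_mod_cast hcp.pos
  refine ⟨b, k, t, c, hb₀, by simpa using hkk₀, by exact_mod_cast ht₀, by simpa using hc₁, hcpZ,
    mul_ne_zero hk1.ne' hc1.ne', fun h => hce (h ▸ dvd_zero _), hce,
    isCoprime_coeff_nakanoPoly hm hcpZ hcw hct, fun j =>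
    isCoprime_eval_derivative_nakanoPoly hm hcpZ hkpZ hcw hct hkt hkc j (hkb j) (hcP j) (hkP j),
    isCoprime_eval_zero_derivative_nakanoPoly hm hcpZ hcw hct fun p hp hpe hpV => ?_, ?_⟩
  · have hpn : (p.natAbs).Prime := Int.prime_iff_natAbs_prime.1 hp
    rw [← Int.natAbs_dvd] at hpe hpV
    by_cases hpL : p.natAbs ∣ L
    · exact hV b k t c hb₀ (by simpa using hkk₀) (by exact_mod_cast ht₀) (by simpa using hc₁)
        _ hpn hpL hpe hpV
    · have hpD : p.natAbs ∣ D := Finset.dvd_prod_of_mem _ (Finset.mem_filter.2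
        ⟨Nat.mem_primeFactors.2 ⟨hpn, Int.natCast_dvd.1 hpV, Int.natAbs_ne_zero.2 hV0⟩, hpL⟩)
      have hpt : (p.natAbs : ℤ) ∣ t := Int.natCast_dvd_natCast.2
        (hpD.trans ⟨k * s, by rw [ht]; ring⟩)
      rw [dvd_add_left (dvd_mul_of_dvd_right hpt _)] at hpe
      have hpe' : p.natAbs ∣ k * c := by exact_mod_cast hpe
      rcases (Nat.Prime.dvd_mul hpn).1 hpe' with h | h
      · rw [(Nat.prime_dvd_prime_iff_eq hpn hkp).1 h] at hpV
        exact hkV hpV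
      · rw [(Nat.prime_dvd_prime_iff_eq hpn hcp).1 h] at hpV
        exact hcV hpV
  · refine nakanoPoly_real_root_unique (B := B) hm hc1 hB1 (fun j => ?_)
      (abs_nakanoCoeff_le hm hk1 hc1 ?_ ?_) ?_
    · have := hle b j
      rw [Int.abs_eq_natAbs]
      exact_mod_cast (by omega : (b j).natAbs ≤ B)
    · have h1 : ((w * t).natAbs : ℤ) ≤ c := by exact_mod_cast (by omega : (w * t).natAbs ≤ c)
      rw [Int.abs_eq_natAbs]
      exact h1.trans (le_mul_of_one_le_left hc1.le (by omega))
    · rw [abs_of_nonneg (Int.natCast_nonneg t)]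
      exact_mod_cast (by omega : t * (m * (2 * k) ^ (m - 1)) ≤ c)
    · exact_mod_cast (by omega : (3 * B) ^ (N + 1) < k)

end GlobalData

section Irreducibility

open Polynomial

theorem irreducible_of_map_eq_X_add_one_pow {f : ℤ[X]} {q n : ℕ} [Fact q.Prime] (hn : n ≠ 0)
    (hdeg : f.natDegree = n) (hf : f.IsPrimitive)
    (hmap : f.map (Int.castRingHom (ZMod q)) = (X + 1) ^ n)
    (heval : ((f.eval (-1) : ℤ) : ZMod (q ^ 2)) ≠ 0) : Irreducible f := by
  have hmonic : ((X + 1 : (ZMod q)[X]) ^ n).Monic := (monic_X_add_C 1).pow n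
  have hlead : algebraMap ℤ (ZMod q) f.leadingCoeff = 1 := by
    have h1 : ((X + 1 : (ZMod q)[X]) ^ n).natDegree = n := by
      rw [← C_1, (monic_X_add_C (1 : ZMod q)).natDegree_pow, natDegree_X_add_C, mul_one]
    rw [Monic, leadingCoeff, h1, ← hmap, coeff_map] at hmonic
    rwa [leadingCoeff, hdeg, algebraMap_int_eq]
  have hX : (X - C (-1 : ℤ)).map (algebraMap ℤ (ZMod q)) = X + 1 := by simp
  refine generalizedEisenstein (K := ZMod q) (q := X - C (-1)) (p := n) ?_ (monic_X_sub_C _) hf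
    (by omega) (by rw [hlead]; exact one_ne_zero) ?_ ?_
  · rw [hX]
    have := irreducible_X_sub_C (-1 : ZMod q)
    simpa using this
  · rw [hlead, hX, C_1, one_mul, ← hmap, algebraMap_int_eq]
  · rw [modByMonic_X_sub_C_eq_C_eval, Polynomial.map_C, Ne, C_eq_zero, Ideal.Quotient.eq_zero_iff_mem,
      algebraMap_int_eq, ZMod.ker_intCastRingHom, Ideal.span_singleton_pow,
      Ideal.mem_span_singleton]
    rw [Ne, ZMod.intCast_zmod_eq_zero_iff_dvd] at heval
    simpa using heval

theorem nakanoPoly_isPrimitive {N m : ℕ} {b : Fin N → ℤ} {k t c : ℤ} (hc : Prime c)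
    (he : ¬ c ∣ k * c + (∏ j, -b j) * t) : (nakanoPoly m b k t c).IsPrimitive := by
  rw [isPrimitive_iff_isUnit_of_C_dvd]
  intro r hr
  have h1 : r ∣ c ^ m := by
    rw [← coeff_succ_nakanoPoly m b k t c]
    exact C_dvd_iff_dvd_coeff _ _ |>.1 hr _
  have h2 : r ∣ (k * c + (∏ j, -b j) * t) ^ m := by
    rw [← eval_nakanoPoly_zero]
    have := eval_dvd (x := 0) hr
    rwa [eval_C] at this
  exact ((hc.irreducible.coprime_iff_not_dvd.2 he).pow (m := m) (n := m)).isUnit_of_dvd' h1 h2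

theorem exists_eisenstein_residues {N m q : ℕ} [Fact q.Prime] (hN : 1 ≤ N)
    (hq : N + 1 ∣ q - 1) (hqm : ¬ q ∣ m) :
    ∃ (b : Fin N → ZMod (q ^ 2)) (t : ZMod (q ^ 2)), ∏ j, -b j = 0 ∧
      (nakanoPoly m b 1 t 1).eval (-1) = q ∧
      (nakanoPoly m b 1 t 1).map (ZMod.castHom (dvd_pow_self q two_ne_zero) (ZMod q)) =
        (X + 1) ^ (N + 1) := by
  have hqp : q.Prime := Fact.out
  obtain ⟨g, hg⟩ := IsCyclic.exists_ofOrder_eq_natCard (α := (ZMod q)ˣ)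
  rw [Nat.card_eq_fintype_card, ZMod.card_units] at hg
  obtain ⟨e, he⟩ := hq
  have hζ : IsPrimitiveRoot ((g ^ e : (ZMod q)ˣ) : ZMod q) (N + 1) := by
    rw [IsPrimitiveRoot.coe_units_iff]
    have h1 := IsPrimitiveRoot.orderOf g
    rw [hg] at h1
    exact h1.pow (by have := hqp.two_le; omega) (he.trans (mul_comm _ _))
  set ζ : ZMod q := ((g ^ e : (ZMod q)ˣ) : ZMod q) with hζdef
  set φ := ZMod.castHom (dvd_pow_self q two_ne_zero) (ZMod q) with hφ
  set b : Fin N → ZMod (q ^ 2) := fun j => ((ζ ^ (j : ℕ)).val : ZMod (q ^ 2)) - 1 with hb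
  have hφb : ∀ j, φ (b j) = ζ ^ (j : ℕ) - 1 := fun j => by simp [hb]
  have hw : ∏ j, -b j = 0 := by
    refine Finset.prod_eq_zero (Finset.mem_univ (⟨0, hN⟩ : Fin N)) ?_
    have h1 : (1 : ZMod q).val = 1 := ZMod.val_one q
    simp only [hb, pow_zero, h1, Nat.cast_one, sub_self, neg_zero]
  set u : ZMod (q ^ 2) := ∏ j, (-1 - b j) with hu
  have hfac : rootsPoly (fun j => φ (b j)) * (X + 1 - C (ζ ^ N)) = (X + 1) ^ (N + 1) - 1 := by
    have h1 := congrArg (fun p => p.comp (X + 1))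
      (X_pow_sub_C_eq_prod hζ N.succ_pos (one_pow (N + 1)))
    simp only [sub_comp, pow_comp, X_comp, C_comp, C_1, Polynomial.prod_comp, mul_one,
      one_comp] at h1
    rw [h1, Finset.prod_range_succ, Finset.prod_range, rootsPoly]
    congr 1
    refine Finset.prod_congr rfl fun j _ => ?_
    rw [hφb, C_sub, C_1]
    ring
  have hφu : φ u * -ζ ^ N = -1 := by
    have h1 := congrArg (Polynomial.eval (-1)) hfac
    simp only [eval_mul, eval_rootsPoly, eval_sub, eval_add, eval_X, eval_one, eval_C, eval_pow,
      neg_add_cancel, ne_eq, Nat.succ_ne_zero, not_false_eq_true, zero_pow, zero_sub] at h1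
    rw [hu, map_prod]
    simpa only [map_sub, map_neg, map_one] using h1
  have huu : IsUnit u := by
    rw [hu]
    refine Finset.prod_induction _ IsUnit (fun _ _ => IsUnit.mul) isUnit_one fun j _ => ?_
    have h1 : -1 - b j = -((ζ ^ (j : ℕ)).val : ZMod (q ^ 2)) := by
      simp only [hb]
      ring
    rw [h1, IsUnit.neg_iff, ZMod.isUnit_iff_coprime]
    refine Nat.Coprime.pow_right 2 ?_
    have := ZMod.val_coe_unit_coprime ((g ^ e) ^ (j : ℕ))
    rwa [Units.val_pow_eq_pow_val] at this
  have hmu : IsUnit (m : ZMod (q ^ 2)) := by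
    rw [ZMod.isUnit_iff_coprime]
    exact ((Nat.Prime.coprime_iff_not_dvd hqp).2 hqm).symm.pow_right 2
  set t : ZMod (q ^ 2) := ((q : ZMod (q ^ 2)) - 1 + u) * (m * u)⁻¹ with ht
  have hmt : m * t * u = (q : ZMod (q ^ 2)) - 1 + u := by
    have := ZMod.mul_inv_of_unit _ (hmu.mul huu)
    rw [ht]
    linear_combination ((q : ZMod (q ^ 2)) - 1 + u) * this
  refine ⟨b, t, hw, ?_, ?_⟩
  · rw [eval_nakanoPoly, hw, nakanoCoeff_zero_left, eval_rootsPoly]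
    simp only [mul_one, one_pow]
    linear_combination hmt
  · have hmt' : φ (m * t) = 1 - ζ ^ N := by
      have h1 := congrArg φ hmt
      rw [map_mul, map_add, map_sub, map_one, map_natCast, ZMod.natCast_self, zero_sub] at h1
      linear_combination (φ (m * t) - 1) * hφu + ζ ^ N * h1
    rw [nakanoPoly, hw, nakanoCoeff_zero_left]
    simp only [one_pow, mul_one, C_1, one_mul, Polynomial.map_add, Polynomial.map_mul, map_X,
      Polynomial.map_one, Polynomial.map_C, map_rootsPoly, hmt']
    rw [C_sub, C_1]
    linear_combination hfac

end Irreducibility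

section LocalWitness

open Polynomial

variable {N m p l : ℕ}

theorem exists_nakanoPoly_simple_root {F : Type*} [Field F] {b : Fin N → F}
    (hw : ∏ j, -b j = 0) {r u : F} (hr : (rootsPoly b).eval r ≠ 0) (hu : u ≠ 0) (hum : u ^ m ≠ 1)
    (hm : (m : F) ≠ 0) : ∃ k t : F, k ≠ 0 ∧ (nakanoPoly m b k t 1).eval r = 0 ∧
      (nakanoPoly m b k t 1).derivative.eval r ≠ 0 := by
  set P := (rootsPoly b).eval r with hP
  set Q := (rootsPoly b).derivative.eval r with hQ
  obtain ⟨k, hk, hkQ⟩ : ∃ k : F, k ≠ 0 ∧ P ^ 2 ≠ k ^ m * Q := by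
    by_contra! h
    have h1 := h 1 one_ne_zero
    have h2 := h u hu
    rw [one_pow, one_mul] at h1
    rw [← h1] at h2
    exact hum (mul_right_cancel₀ (pow_ne_zero 2 hr) (by rw [← h2, one_mul]))
  have hM : nakanoCoeff m (∏ j, -b j) k (-(r * P + k ^ m) / (P * (m * k ^ (m - 1)))) 1 =
      -(r * P + k ^ m) / P := by
    rw [hw, nakanoCoeff_zero_left, mul_one]
    field_simp
  refine ⟨k, -(r * P + k ^ m) / (P * (m * k ^ (m - 1))), hk, ?_, ?_⟩
  · rw [eval_nakanoPoly, hM, ← hP]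
    field_simp
    ring
  · rw [eval_derivative_nakanoPoly, hM, ← hP, ← hQ]
    intro h
    field_simp at h
    apply hkQ
    linear_combination h

theorem ZMod.exists_one_sub_pow_pow_ne_one [Fact l.Prime] (hp : p.Prime) (hpm : p ∣ m)
    (hml : m ∣ l - 1) (hl : 4 * m ^ 2 < l) :
    ∃ y : (ZMod l)ˣ, ∃ g : (ZMod l)ˣ, (g : ZMod l) = 1 - (y : ZMod l) ^ m ∧
      g ^ ((l - 1) / p) ≠ 1 := by
  have hlp : l.Prime := Fact.out
  have hpl : p ∣ l - 1 := hpm.trans hml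
  obtain ⟨G, hG⟩ := exists_pow_ne_one_of_isCyclic (G := (ZMod l)ˣ) (k := (l - 1) / p)
    (Nat.div_pos (Nat.le_of_dvd (by have := hlp.two_le; omega) hpl) hp.pos).ne' (by
      rw [Nat.card_eq_fintype_card, ZMod.card_units]
      exact Nat.div_lt_self (by have := hlp.two_le; omega) hp.one_lt)
  by_contra! hall
  have hχ : ∀ a b : (powMonoidHom m : (ZMod l)ˣ →* (ZMod l)ˣ).range, a ≠ b →
      ∃ d : (ZMod l)ˣ, (d : ZMod l) = (a : (ZMod l)ˣ) - (b : (ZMod l)ˣ) ∧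
        d ^ ((l - 1) / p) = 1 := by
    rintro ⟨-, a, rfl⟩ ⟨-, b, rfl⟩ hab
    have hne : (1 : ZMod l) - ((b / a : (ZMod l)ˣ) : ZMod l) ^ m ≠ 0 := by
      rw [sub_ne_zero, ← Units.val_pow_eq_pow_val, ← Units.val_one, Ne, Units.val_inj, div_pow,
        eq_comm, div_eq_one]
      exact fun h => hab (Subtype.ext h.symm)
    refine ⟨a ^ m * Units.mk0 _ hne, ?_, ?_⟩
    · have ha : ((a : ZMod l)) ^ m ≠ 0 := pow_ne_zero m a.ne_zero
      simp only [Units.val_mul, Units.val_pow_eq_pow_val, Units.val_mk0, powMonoidHom_apply,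
        Units.val_div_eq_div_val, div_pow]
      field_simp
    · rw [mul_pow, hall _ _ (Units.val_mk0 hne), mul_one, ← pow_mul]
      obtain ⟨e, rfl⟩ := hpm
      rw [mul_right_comm, Nat.mul_div_cancel' hpl, pow_mul, ZMod.units_pow_card_sub_one_eq_one,
        one_pow]
  have hinj : Function.Injective fun z : (powMonoidHom m : (ZMod l)ˣ →* (ZMod l)ˣ).range ×
      (powMonoidHom m : (ZMod l)ˣ →* (ZMod l)ˣ).range =>
      ((z.1 : (ZMod l)ˣ) : ZMod l) + (G : ZMod l) * ((z.2 : (ZMod l)ˣ) : ZMod l) := by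
    rintro ⟨a, b⟩ ⟨a', b'⟩ h
    simp only at h
    by_cases hb : b = b'
    · subst hb
      have := add_right_cancel h
      exact Prod.ext (Subtype.ext (Units.ext this)) rfl
    · have ha : a ≠ a' := by
        rintro rfl
        have := mul_left_cancel₀ G.ne_zero (add_left_cancel h)
        exact hb (Subtype.ext (Units.ext this))
      obtain ⟨d, hd, hd1⟩ := hχ a a' ha
      obtain ⟨d', hd', hd1'⟩ := hχ b' b (Ne.symm hb)
      have : d = G * d' := by
        ext
        rw [Units.val_mul, hd, hd']
        linear_combination h
      rw [this, mul_pow, hd1', mul_one] at hd1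
      exact (hG hd1).elim
  have hcard := Nat.card_le_card_of_injective _ hinj
  rw [Nat.card_prod, Nat.card_zmod, IsCyclic.card_powMonoidHom_range, Nat.card_eq_fintype_card,
    ZMod.card_units, Nat.gcd_eq_right hml] at hcard
  obtain ⟨e, he⟩ := hml
  have hl1 : l = m * e + 1 := by have := hlp.two_le; omega
  have hm0 : 0 < m := by
    rcases Nat.eq_zero_or_pos m with rfl | h
    · exact absurd hlp (by rw [hl1, zero_mul]; exact Nat.not_prime_one)
    · exact h
  rw [he, Nat.mul_div_cancel_left _ hm0, hl1] at hcard
  rw [hl1] at hl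
  have h4 : 4 * m ≤ e := by
    have h5 : m * (4 * m) ≤ m * e := by nlinarith
    exact Nat.le_of_mul_le_mul_left h5 hm0
  nlinarith

/-- Residues modulo `l` for which the polynomial `nakanoPoly` has a simple root `r`, such that a
character of order `p` is constant on the `r - a i`, `i ∈ S`, and trivial on the others, where
`a = (0, b)`. -/
structure NakanoWitness (m p l : ℕ) (S : Finset (Fin (N + 1))) (b : Fin N → ZMod l)
    (k t : ZMod l) : Prop where
  k_ne_zero : k ≠ 0
  ne_zero_or : k + (∏ j, -b j) * t ≠ 0 ∨
    (∏ j, -b j) ^ 2 - k ^ m * (rootsPoly b).derivative.eval 0 ≠ 0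
  exists_root : ∃ (r : ZMod l) (x : Fin (N + 1) → (ZMod l)ˣ) (η : (ZMod l)ˣ),
    (nakanoPoly m b k t 1).eval r = 0 ∧ (nakanoPoly m b k t 1).derivative.eval r ≠ 0 ∧
    (∀ i, (x i : ZMod l) = r - (Fin.cons 0 b : Fin (N + 1) → ZMod l) i) ∧ η ≠ 1 ∧
    ∀ i, x i ^ ((l - 1) / p) = if i ∈ S then η else 1

theorem exists_nakanoWitness_of_prod_eq_zero [Fact l.Prime] (hp : p.Prime) (hpm : p ∣ m)
    (hml : m ∣ l - 1) (hl : 4 * m ^ 2 < l) (S : Finset (Fin (N + 1)))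
    (h : ∀ g : (ZMod l)ˣ, ∃ (b : Fin N → ZMod l) (r : ZMod l), ∏ j, -b j = 0 ∧
      ∀ i, r - (Fin.cons 0 b : Fin (N + 1) → ZMod l) i = if i ∈ S then (g : ZMod l) else 1) :
    ∃ b k t, NakanoWitness m p l S b k t := by
  have hlp : l.Prime := Fact.out
  have hl0 : 0 < l - 1 := by have := hlp.two_le; omega
  have hm0 : 0 < m := Nat.pos_of_dvd_of_pos hml hl0
  have hmlt : m < l - 1 := by
    have := Nat.le_self_pow two_ne_zero m
    omega
  obtain ⟨g, hg⟩ := IsCyclic.exists_ofOrder_eq_natCard (α := (ZMod l)ˣ)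
  rw [Nat.card_eq_fintype_card, ZMod.card_units] at hg
  have hpl : p ∣ l - 1 := hpm.trans hml
  have hgm : g ^ m ≠ 1 := fun h => by
    have := Nat.le_of_dvd hm0 (hg ▸ orderOf_dvd_of_pow_eq_one h)
    omega
  have hgp : g ^ ((l - 1) / p) ≠ 1 := fun h => by
    have h1 := Nat.le_of_dvd (Nat.div_pos (Nat.le_of_dvd hl0 hpl) hp.pos)
      (hg ▸ orderOf_dvd_of_pow_eq_one h)
    have := Nat.div_lt_self hl0 hp.one_lt
    omega
  have hml0 : (m : ZMod l) ≠ 0 := by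
    rw [Ne, ZMod.natCast_eq_zero_iff]
    exact Nat.not_dvd_of_pos_of_lt hm0 (by omega)
  obtain ⟨b, r, hw, hx⟩ := h g
  have hP : (rootsPoly b).eval r ≠ 0 := by
    rw [eval_rootsPoly]
    refine Finset.prod_ne_zero_iff.2 fun j _ => ?_
    have := hx j.succ
    rw [Fin.cons_succ] at this
    rw [this]
    split_ifs
    exacts [g.ne_zero, one_ne_zero]
  obtain ⟨k, t, hk, h0, h1⟩ := exists_nakanoPoly_simple_root hw hP g.ne_zero
    (by rw [← Units.val_pow_eq_pow_val, Ne, Units.val_eq_one]; exact hgm) hml0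
  refine ⟨b, k, t, hk, Or.inl (by simpa [hw] using hk), r, fun i => if i ∈ S then g else 1,
    g ^ ((l - 1) / p), h0, h1, fun i => ?_, hgp, fun i => ?_⟩
  · rw [hx]
    dsimp only
    split_ifs <;> rfl
  · dsimp only
    split_ifs
    · rfl
    · exact one_pow _

theorem exists_nakanoWitness_univ [Fact l.Prime] (hp : p.Prime) (hpm : p ∣ m)
    (hml : m ∣ l - 1) (hl : 4 * m ^ 2 < l) (hN : 1 ≤ N) :
    ∃ b k t, NakanoWitness (N := N) m p l Finset.univ b k t :=
  exists_nakanoWitness_of_prod_eq_zero hp hpm hml hl _ fun g => ⟨fun _ => 0, g,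
    Finset.prod_eq_zero (Finset.mem_univ ⟨0, hN⟩) neg_zero, fun i => by
      refine Fin.cases ?_ (fun j => ?_) i <;> simp⟩

theorem exists_nakanoWitness_succ [Fact l.Prime] (hp : p.Prime) (hpm : p ∣ m)
    (hml : m ∣ l - 1) (hl : 4 * m ^ 2 < l) (hN : 2 ≤ N) (j : Fin N) :
    ∃ b k t, NakanoWitness m p l {j.succ} b k t := by
  have : Nontrivial (Fin N) := Fin.nontrivial_iff_two_le.2 hN
  obtain ⟨j', hj'⟩ := exists_ne j
  refine exists_nakanoWitness_of_prod_eq_zero hp hpm hml hl _ fun g =>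
    ⟨Pi.single j (1 - g), 1, Finset.prod_eq_zero (Finset.mem_univ j') (by simp [hj']), fun i => ?_⟩
  refine Fin.cases ?_ (fun i => ?_) i
  · simp [(Fin.succ_ne_zero j).symm]
  · simp only [Fin.cons_succ, Finset.mem_singleton, Fin.succ_inj]
    by_cases h : i = j
    · subst h
      simp
    · simp [h]

theorem exists_nakanoWitness_one [Fact l.Prime] (hp : p.Prime) (hpm : p ∣ m)
    (hml : m ∣ l - 1) (hl : 4 * m ^ 2 < l) :
    ∃ b k t, NakanoWitness (N := 1) m p l {0} b k t := by
  obtain ⟨y, g, hg, hgp⟩ := ZMod.exists_one_sub_pow_pow_ne_one hp hpm hml hl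
  have hy : (y : ZMod l) ≠ 0 := y.ne_zero
  have hym : (y : ZMod l) ^ m ≠ 0 := pow_ne_zero m hy
  have hw : ∏ j : Fin 1, -(fun _ => -(y : ZMod l) ^ m : Fin 1 → ZMod l) j = (y : ZMod l) ^ m := by
    simp
  have hP : rootsPoly (fun _ => -(y : ZMod l) ^ m : Fin 1 → ZMod l) = X + C ((y : ZMod l) ^ m) := by
    simp [rootsPoly]
  have hP' : (rootsPoly (fun _ => -(y : ZMod l) ^ m : Fin 1 → ZMod l)).derivative = 1 := by
    rw [hP, derivative_add, derivative_X, derivative_C, add_zero]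
  have he : (y : ZMod l) + (y : ZMod l) ^ m * (-y / (y : ZMod l) ^ m) = 0 := by
    field_simp
    ring
  have hm0 : m ≠ 0 := by
    rintro rfl
    simp at hg
  have hM : nakanoCoeff m ((y : ZMod l) ^ m) y (-y / (y : ZMod l) ^ m) 1 = -1 := by
    have h1 := mul_nakanoCoeff m ((y : ZMod l) ^ m) y (-y / (y : ZMod l) ^ m) 1
    rw [mul_one, he, zero_pow hm0] at h1
    exact mul_left_cancel₀ hym (by rw [h1]; ring)
  refine ⟨fun _ => -(y : ZMod l) ^ m, y, -y / (y : ZMod l) ^ m, hy, Or.inr ?_, g, ![g, 1],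
    g ^ ((l - 1) / p), ?_, ?_, ?_, hgp, ?_⟩
  · rw [hw, hP', eval_one]
    have : ((y : ZMod l) ^ m) * (g : ZMod l) ≠ 0 := mul_ne_zero hym g.ne_zero
    rw [hg] at this
    intro h
    apply this
    linear_combination -h
  · rw [eval_nakanoPoly, hw, hM, hP]
    simp only [eval_add, eval_X, eval_C, one_pow, hg]
    ring
  · rw [eval_derivative_nakanoPoly, hw, hM, hP', hP]
    have : (g : ZMod l) ≠ 0 := g.ne_zero
    simpa [hg] using this
  · intro i
    fin_cases i <;> simp [hg]
  · intro i
    fin_cases i <;> simp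

end LocalWitness

section Existence

open Polynomial

variable {N m p l : ℕ}

theorem exists_nakanoWitness (hN : 1 ≤ N) : ∃ i₀ : Fin (N + 1), ∀ (m p l : ℕ) [Fact l.Prime],
    p.Prime → p ∣ m → m ∣ l - 1 → 4 * m ^ 2 < l → ∀ i : Fin (N + 1),
    ∃ b k t, NakanoWitness (N := N) m p l (if i = i₀ then Finset.univ else {i}) b k t := by
  rcases hN.eq_or_lt with rfl | hN
  · refine ⟨1, fun m p l _ hp hpm hml hl i => ?_⟩
    fin_cases i
    · exact exists_nakanoWitness_one hp hpm hml hl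
    · exact exists_nakanoWitness_univ hp hpm hml hl le_rfl
  · refine ⟨0, fun m p l _ hp hpm hml hl i => ?_⟩
    refine Fin.cases ?_ (fun j => ?_) i
    · rw [if_pos rfl]
      exact exists_nakanoWitness_univ hp hpm hml hl (by omega)
    · rw [if_neg (Fin.succ_ne_zero j)]
      exact exists_nakanoWitness_succ hp hpm hml hl hN j

theorem NakanoWitness.dvd_sum [Fact l.Prime] {S : Finset (Fin (N + 1))} {b : Fin N → ℤ}
    {k t c : ℤ} (W : NakanoWitness m p l S (fun j => (b j : ZMod l)) k t)
    (hc : (c : ZMod l) = 1) (hp : p.Prime) (hpl : p ∣ l - 1) {n : Fin (N + 1) → ℤ}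
    (h : ∀ (r : ℤ) (x : Fin (N + 1) → (ZMod l)ˣ),
      (((nakanoPoly m b k t c).eval r : ℤ) : ZMod l) = 0 →
      (((nakanoPoly m b k t c).derivative.eval r : ℤ) : ZMod l) ≠ 0 →
      (∀ i, (x i : ZMod l) = r - ((Fin.cons 0 b : Fin (N + 1) → ℤ) i : ℤ)) →
      ∏ i, (x i ^ ((l - 1) / p)) ^ n i = 1) : (p : ℤ) ∣ ∑ i ∈ S, n i := by
  obtain ⟨-, -, r, x, η, h0, h1, hx, hη, hxη⟩ := W
  obtain ⟨r, rfl⟩ := ZMod.intCast_surjective r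
  have hmap : (nakanoPoly m b k t c).map (Int.castRingHom (ZMod l)) =
      nakanoPoly m (fun j => (b j : ZMod l)) k t 1 := by
    rw [map_nakanoPoly, ← hc]
    rfl
  have h2 := h r x (by
    rw [← hmap] at h0
    simpa [eval_intCast_map] using h0) (by
    rw [← hmap, derivative_map] at h1
    simpa [eval_intCast_map] using h1) fun i => by
      rw [hx i]
      refine Fin.cases ?_ (fun j => ?_) i <;> simp
  have h3 : η ^ (∑ i ∈ S, n i) = 1 := by
    have h4 : ∀ i, (x i ^ ((l - 1) / p)) ^ n i = if i ∈ S then η ^ n i else 1 := fun i => by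
      rw [hxη]
      split_ifs
      exacts [rfl, one_zpow _]
    rw [← h2, Finset.prod_congr rfl fun i _ => h4 i, Finset.prod_ite_mem, Finset.univ_inter]
    exact (congrArg Multiplicative.toAdd.symm (map_sum (zmultiplesHom (Additive (ZMod l)ˣ)
      (Additive.ofMul η)) n S) :)
  by_cases hS : ∃ i, i ∈ S
  · obtain ⟨i, hi⟩ := hS
    have hηp : η ^ p = 1 := by
      have := hxη i
      rw [if_pos hi] at this
      rw [← this, ← pow_mul, Nat.div_mul_cancel hpl, ZMod.units_pow_card_sub_one_eq_one]
    have := Fact.mk hp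
    rw [← orderOf_eq_prime hηp hη]
    exact orderOf_dvd_iff_zpow_eq_one.2 h3
  · rw [Finset.sum_eq_zero fun i hi => (hS ⟨i, hi⟩).elim]
    exact dvd_zero _

theorem NakanoWitness.not_dvd {S : Finset (Fin (N + 1))} {b : Fin N → ℤ} {k t c : ℤ}
    (W : NakanoWitness m p l S (fun j => (b j : ZMod l)) k t) (hc : (c : ZMod l) = 1)
    (he : (l : ℤ) ∣ k * c + (∏ j, -b j) * t) :
    ¬ (l : ℤ) ∣ (∏ j, -b j) ^ 2 - k ^ m * (rootsPoly b).derivative.eval 0 := by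
  intro hV
  rw [← ZMod.intCast_zmod_eq_zero_iff_dvd] at he hV
  have h1 := W.ne_zero_or
  have h2 : (rootsPoly fun j => (b j : ZMod l)).derivative.eval 0 =
      ((rootsPoly b).derivative.eval 0 : ℤ) := by
    have h3 := map_rootsPoly (Int.castRingHom (ZMod l)) b
    simp only [eq_intCast] at h3
    rw [← h3, derivative_map, ← Int.cast_zero, eval_intCast_map, eq_intCast]
    rw [Int.cast_id]
  rw [h2] at h1
  push_cast at he hV
  rw [hc, mul_one] at he
  exact h1.elim (fun h => h he) (fun h => h hV)

theorem ZMod.exists_forall_intCast_eq {ι : Type*} [Fintype ι] {a : ι → ℕ}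
    (ha : Pairwise (Function.onFun Nat.Coprime a)) (v : ∀ i, ZMod (a i)) :
    ∃ v₀ : ZMod (∏ i, a i), (∀ z : ℤ, (z : ZMod (∏ i, a i)) = v₀ → ∀ i, (z : ZMod (a i)) = v i) ∧
      ((∀ i, IsUnit (v i)) → IsUnit v₀) := by
  refine ⟨(ZMod.prodEquivPi a ha).symm v, fun z hz i => ?_, fun h => ?_⟩
  · rw [RingEquiv.eq_symm_apply, map_intCast] at hz
    rw [← hz, Pi.intCast_apply]
  · exact (Pi.isUnit_iff.2 h).map (ZMod.prodEquivPi a ha).symm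

theorem exists_injective_prime_modEq_one (ι : Type*) [Finite ι] {A : ℕ} (hA : A ≠ 0) (B : ℕ) :
    ∃ l : ι → ℕ, Function.Injective l ∧ ∀ i, (l i).Prime ∧ B < l i ∧ A ∣ l i - 1 := by
  have hinf : {l : ℕ | l.Prime ∧ B < l ∧ A ∣ l - 1}.Infinite := by
    refine Set.infinite_of_forall_exists_gt fun n => ?_
    obtain ⟨l, hl, hnl, hmod⟩ := Nat.exists_prime_gt_modEq_one (max n B) hA
    exact ⟨l, ⟨hl, (le_max_right _ _).trans_lt hnl,
      (Nat.modEq_iff_dvd' hl.one_le).1 hmod.symm⟩, (le_max_left _ _).trans_lt hnl⟩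
  have := hinf.to_subtype
  have := Fintype.ofFinite ι
  let F := Infinite.natEmbedding {l : ℕ | l.Prime ∧ B < l ∧ A ∣ l - 1}
  exact ⟨fun i => F (Fintype.equivFin ι i), fun i j h => (Fintype.equivFin ι).injective
    (Fin.ext (F.injective (Subtype.ext h))), fun i => (F (Fintype.equivFin ι i)).2⟩

/-- There is a polynomial `nakanoPoly m b k t c` satisfying all the hypotheses of
`exists_injective_classGroup_of_polynomial`. -/
theorem exists_nakanoPoly (hN : 1 ≤ N) (hm : m ≠ 0) :
    ∃ (b : Fin N → ℤ) (k t c : ℤ), c ≠ 0 ∧ k * c ≠ 0 ∧ k * c + (∏ j, -b j) * t ≠ 0 ∧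
      Irreducible (nakanoPoly m b k t c) ∧
      IsCoprime c ((nakanoPoly m b k t c).coeff N) ∧
      (∀ j, IsCoprime (k * c) ((nakanoPoly m b k t c).derivative.eval (b j))) ∧
      IsCoprime (k * c + (∏ j, -b j) * t) ((nakanoPoly m b k t c).derivative.eval 0) ∧
      (∀ x y : ℝ, aeval x (nakanoPoly m b k t c) = 0 → aeval y (nakanoPoly m b k t c) = 0 →
        x = y) ∧
      ∀ p, p.Prime → p ∣ m → ∀ n : Fin (N + 1) → ℤ,
        (∀ (l : ℕ) [Fact l.Prime], p * (2 * (N + 1)).factorial ∣ l - 1 →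
          ∀ (r : ℤ) (x : Fin (N + 1) → (ZMod l)ˣ),
          (((nakanoPoly m b k t c).eval r : ℤ) : ZMod l) = 0 →
          (((nakanoPoly m b k t c).derivative.eval r : ℤ) : ZMod l) ≠ 0 →
          (∀ i, (x i : ZMod l) = r - ((Fin.cons 0 b : Fin (N + 1) → ℤ) i : ℤ)) →
          ∏ i, (x i ^ ((l - 1) / p)) ^ n i = 1) → ∀ i, (p : ℤ) ∣ n i := by
  obtain ⟨i₀, hwit⟩ := exists_nakanoWitness hN
  obtain ⟨l, hlinj, hl⟩ := exists_injective_prime_modEq_one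
    (Option (Fin (N + 1) × m.primeFactors)) (A := m * (2 * (N + 1)).factorial)
    (by positivity) (4 * m ^ 2)
  have hfact : ∀ i, Fact (l i).Prime := fun i => ⟨(hl i).1⟩
  have hml : ∀ i, m ∣ l i - 1 := fun i => (dvd_mul_right _ _).trans (hl i).2.2
  obtain ⟨b₁, t₁, hw₁, heval, hmap⟩ := exists_eisenstein_residues (m := m) (q := l none) hN
    (((Nat.dvd_factorial N.succ_pos (by omega)).trans (dvd_mul_left _ _)).trans (hl none).2.2)
    (Nat.not_dvd_of_pos_of_lt (by omega) (by
      have := Nat.le_self_pow two_ne_zero m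
      have := (hl none).2.1
      omega))
  choose b₂ k₂ t₂ hW using fun (i : Fin (N + 1)) (p : m.primeFactors) =>
    hwit m p (l (some (i, p))) (Nat.prime_of_mem_primeFactors p.2)
      (Nat.dvd_of_mem_primeFactors p.2) (hml _) (hl _).2.1 i
  let a : Option (Fin (N + 1) × m.primeFactors) → ℕ := fun o => o.elim (l none ^ 2)
    fun ip => l (some ip)
  have ha : Pairwise (Function.onFun Nat.Coprime a) := by
    have h1 : ∀ i j, i ≠ j → (l i).Coprime (l j) := fun i j hij =>
      (Nat.coprime_primes (hl i).1 (hl j).1).2 (hlinj.ne hij)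
    rintro (_ | i) (_ | j) hij
    · exact (hij rfl).elim
    · exact (h1 _ _ hij).pow_left 2
    · exact (h1 _ _ hij).pow_right 2
    · exact h1 _ _ hij
  have ha0 : ∀ i, a i ≠ 0 := by
    rintro (_ | i)
    · exact pow_ne_zero 2 (hl _).1.ne_zero
    · exact (hl _).1.ne_zero
  have hL : NeZero (∏ i, a i) := ⟨Finset.prod_ne_zero_iff.2 fun i _ => ha0 i⟩
  choose b₀ hb₀ _ using fun j : Fin N => ZMod.exists_forall_intCast_eq ha
    (Option.rec (b₁ j) fun ip => b₂ ip.1 ip.2 j)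
  obtain ⟨k₀, hk₀, hk₀u⟩ := ZMod.exists_forall_intCast_eq ha
    (Option.rec 1 fun ip => k₂ ip.1 ip.2)
  obtain ⟨t₀, ht₀, -⟩ := ZMod.exists_forall_intCast_eq ha
    (Option.rec t₁ fun ip => t₂ ip.1 ip.2)
  have hc₀ : ∀ c : ℤ, (c : ZMod (∏ i, a i)) = 1 → ∀ i, (c : ZMod (a i)) = 1 := fun c hc i => by
    have h1 := congrArg (ZMod.castHom (Finset.dvd_prod_of_mem a (Finset.mem_univ i))
      (ZMod (a i))) hc
    rwa [map_intCast, map_one] at h1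
  have hunit : IsUnit k₀ := by
    refine hk₀u ?_
    rintro (_ | ⟨i, p⟩)
    · exact isUnit_one
    · exact isUnit_iff_ne_zero.2 (hW i p).k_ne_zero
  obtain ⟨b, k, t, c, hb, hk, ht, hc, hcp, hkc, he, hce, hcop, hcopb, hcop0, huniq⟩ :=
    exists_nakanoPoly_of_residues hm b₀ k₀ t₀ hunit (by
      intro b k t c hb hk ht hc p hp hpL hpe hpV
      obtain ⟨o, -, hpo⟩ := (Prime.dvd_finsetProd_iff (Nat.prime_iff.1 hp) _).1 hpL
      rcases o with _ | ⟨i, p'⟩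
      · have hpq : p = l none :=
          (Nat.prime_dvd_prime_iff_eq hp (hl none).1).1 (hp.dvd_of_dvd_pow hpo)
        have h2 : (fun j => (b j : ZMod (l none ^ 2))) = b₁ :=
          funext fun j => hb₀ j (b j) (hb j) none
        have h3 : (k : ZMod (l none ^ 2)) = 1 := hk₀ k hk none
        have h5 : (c : ZMod (l none ^ 2)) = 1 := hc₀ c hc none
        have h6 : ((k * c + (∏ j, -b j) * t - 1 : ℤ) : ZMod (l none ^ 2)) = 0 := by
          have h8 : ∏ j, -(b j : ZMod (l none ^ 2)) = 0 := by rw [← hw₁, ← h2]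
          push_cast
          rw [h3, h5, h8]
          ring
        rw [ZMod.intCast_zmod_eq_zero_iff_dvd] at h6
        have h7 : (p : ℤ) ∣ k * c + (∏ j, -b j) * t - 1 := by
          refine dvd_trans ?_ h6
          rw [hpq]
          exact_mod_cast dvd_pow_self _ two_ne_zero
        rw [dvd_sub_right hpe] at h7
        exact (Nat.prime_iff_prime_int.1 hp).not_isUnit (isUnit_of_dvd_one h7)
      · obtain rfl : p = l (some (i, p')) := (Nat.prime_dvd_prime_iff_eq hp (hl _).1).1 hpo
        have h2 : b₂ i p' = fun j => (b j : ZMod (l (some (i, p')))) :=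
          funext fun j => (hb₀ j (b j) (hb j) (some (i, p'))).symm
        have h3 : k₂ i p' = k := (hk₀ k hk (some (i, p'))).symm
        have h4 : t₂ i p' = t := (ht₀ t ht (some (i, p'))).symm
        have h1 := hW i p'
        rw [h2, h3, h4] at h1
        exact h1.not_dvd (hc₀ c hc (some (i, p'))) hpe hpV)
  have hW' : ∀ (i : Fin (N + 1)) (p : m.primeFactors), NakanoWitness m p (l (some (i, p)))
      (if i = i₀ then Finset.univ else {i}) (fun j => (b j : ZMod (l (some (i, p))))) k t := by
    intro i p
    have h1 := hW i p
    have h2 : b₂ i p = fun j => (b j : ZMod (l (some (i, p)))) :=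
      funext fun j => (hb₀ j (b j) (hb j) (some (i, p))).symm
    have h3 : k₂ i p = k := (hk₀ k hk (some (i, p))).symm
    have h4 : t₂ i p = t := (ht₀ t ht (some (i, p))).symm
    rwa [h2, h3, h4] at h1
  have hmapq : (nakanoPoly m b k t c).map (Int.castRingHom (ZMod (l none ^ 2))) =
      nakanoPoly m b₁ 1 t₁ 1 := by
    have h2 : b₁ = fun j => (b j : ZMod (l none ^ 2)) :=
      funext fun j => (hb₀ j (b j) (hb j) none).symm
    have h3 : 1 = (k : ZMod (l none ^ 2)) := (hk₀ k hk none).symm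
    have h4 : t₁ = (t : ZMod (l none ^ 2)) := (ht₀ t ht none).symm
    have h5 : 1 = (c : ZMod (l none ^ 2)) := (hc₀ c hc none).symm
    rw [map_nakanoPoly, h2, h4]
    simp only [eq_intCast, ← h3, ← h5]
  refine ⟨b, k, t, c, hcp.ne_zero, hkc, he, ?_, hcop, hcopb, hcop0, huniq, ?_⟩
  · refine irreducible_of_map_eq_X_add_one_pow (q := l none) (n := N + 1) N.succ_ne_zero
      (natDegree_nakanoPoly m b k t hcp.ne_zero) (nakanoPoly_isPrimitive hcp hce) ?_ ?_
    · rw [← hmap, ← hmapq, Polynomial.map_map]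
      congr 1
      exact RingHom.ext_int _ _
    · rw [← hmapq] at heval
      have h1 := eval_intCast_map (Int.castRingHom (ZMod (l none ^ 2)))
        (nakanoPoly m b k t c) (-1)
      rw [Int.cast_neg, Int.cast_one, heval] at h1
      rw [Int.cast_id, eq_intCast] at h1
      rw [← h1, Ne, ZMod.natCast_eq_zero_iff]
      intro h2
      have h3 := Nat.le_of_dvd (hl none).1.pos h2
      have h4 := (hl none).1.one_lt
      nlinarith
  · intro p hp hpm n h
    let p' : m.primeFactors := ⟨p, Nat.mem_primeFactors.2 ⟨hp, hpm, hm⟩⟩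
    have hsum : ∀ i, (p : ℤ) ∣ ∑ j ∈ if i = i₀ then Finset.univ else {i}, n j := fun i =>
      (hW' i p').dvd_sum (hc₀ c hc (some (i, p'))) hp (hpm.trans (hml _))
        (h (l (some (i, p'))) ((mul_dvd_mul_right hpm _).trans (hl _).2.2))
    have hne : ∀ i, i ≠ i₀ → (p : ℤ) ∣ n i := fun i hi => by
      have := hsum i
      rwa [if_neg hi, Finset.sum_singleton] at this
    intro i
    by_cases hi : i = i₀
    · have := hsum i
      rw [if_pos hi, ← Finset.add_sum_erase _ _ (Finset.mem_univ i)] at this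
      exact (dvd_add_left (Finset.dvd_sum fun j hj =>
        hne j (hi ▸ (Finset.mem_erase.1 hj).1))).1 this
    · exact hne i hi

end Existence

section Fields

open Polynomial

theorem exists_numberField_injective {N m : ℕ} (hN : 1 ≤ N) (hm : m ≠ 0) :
    ∃ (K : Type) (_ : Field K) (_ : NumberField K), Module.finrank ℚ K = N + 1 ∧
      ∃ g : (Fin ((N + 1) / 2 + 1) → ZMod m) →+ Additive (ClassGroup (𝓞 K)),
        Function.Injective g := by
  obtain ⟨b, k, t, c, hc, hkc, he, hirr, hcop, hcopb, hcop0, huniq, hind⟩ :=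
    exists_nakanoPoly (m := m) hN hm
  have hdeg := natDegree_nakanoPoly m b k t hc
  have hirrQ : Irreducible ((nakanoPoly m b k t c).map (Int.castRingHom ℚ)) :=
    ((hirr.isPrimitive (by omega)).irreducible_iff_irreducible_map_fraction_map (K := ℚ)).1 hirr
  have hfact := Fact.mk hirrQ
  have hroot : aeval (AdjoinRoot.root ((nakanoPoly m b k t c).map (Int.castRingHom ℚ)))
      (nakanoPoly m b k t c) = 0 := by
    have h1 := AdjoinRoot.aeval_eq (f := (nakanoPoly m b k t c).map (Int.castRingHom ℚ))
      ((nakanoPoly m b k t c).map (algebraMap ℤ ℚ))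
    rw [aeval_map_algebraMap] at h1
    exact h1.trans AdjoinRoot.mk_self
  have hrank : Module.finrank ℚ
      (AdjoinRoot ((nakanoPoly m b k t c).map (Int.castRingHom ℚ))) = N + 1 := by
    rw [← hdeg, ← natDegree_map_eq_of_injective (Int.castRingHom ℚ).injective_int]
    exact finrank_quotient_span_eq_natDegree
  refine ⟨AdjoinRoot ((nakanoPoly m b k t c).map (Int.castRingHom ℚ)), inferInstance,
    inferInstance, hrank, ?_⟩
  refine exists_injective_classGroup_of_polynomial hm hN
    (a := Fin.cons 0 b) (u := Fin.cons (k * c + (∏ j, -b j) * t) fun _ => k * c)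
    hdeg (leadingCoeff_nakanoPoly m b k t hc) hcop ?_ ?_ ?_ hroot ?_ hrank ?_ huniq hind
  · refine Fin.cases ?_ fun j => ?_
    · simpa using eval_nakanoPoly_zero m b k t c
    · simpa using eval_nakanoPoly_self m b k t c j
  · exact Fin.cases (by simpa using he) fun j => by simpa using hkc
  · exact Fin.cases (by simpa using hcop0) fun j => by simpa using hcopb j
  · refine eq_top_iff.2 fun x _ => ?_
    exact IntermediateField.algebra_adjoin_le_adjoin ℚ _
      (AdjoinRoot.adjoinRoot_eq_top (R := ℚ) ▸ Algebra.mem_top)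
  · intro l _ ρ hρ
    refine ⟨AdjoinRoot.lift (Rat.castHom _) ρ ?_, AdjoinRoot.lift_root _⟩
    rw [eval₂_map, ← hρ, aeval_def]
    congr 1

/-- Multiplication by `n` as a map from `ℤ/mℤ` to `ℤ/mnℤ`. -/
noncomputable def zmodMulHom (m n : ℕ) : ZMod m →+ ZMod (m * n) :=
  ZMod.lift m ⟨zmultiplesHom _ (n : ZMod (m * n)), by
    rw [zmultiplesHom_apply, natCast_zsmul, nsmul_eq_mul, ← Nat.cast_mul, ZMod.natCast_self]⟩

theorem zmodMulHom_injective (m : ℕ) {n : ℕ} (hn : n ≠ 0) :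
    Function.Injective (zmodMulHom m n) := by
  refine (ZMod.lift_injective _).2 fun z hz => ?_
  have h1 : ((z * n : ℤ) : ZMod (m * n)) = 0 := by
    simpa using hz
  rw [ZMod.intCast_zmod_eq_zero_iff_dvd, Nat.cast_mul,
    mul_dvd_mul_iff_right (by exact_mod_cast hn)] at h1
  exact (ZMod.intCast_zmod_eq_zero_iff_dvd _ _).2 h1

/-- Class groups of isomorphic number fields are isomorphic. -/
noncomputable def classGroupEquiv {K L : Type*} [Field K] [Field L] (e : K ≃+* L) :
    ClassGroup (𝓞 K) ≃* ClassGroup (𝓞 L) :=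
  ClassGroup.mulEquiv (RingOfIntegers.mapRingEquiv e)

theorem exists_subfield_injective {N m : ℕ} (hN : 1 ≤ N) (hm : m ≠ 0) :
    ∃ K : Subfield ℂ, NumberField K ∧ Module.finrank ℚ K = N + 1 ∧
      ∃ g : (Fin ((N + 1) / 2 + 1) → ZMod m) →+ Additive (ClassGroup (𝓞 K)),
        Function.Injective g := by
  obtain ⟨K, _, _, hK, g, hg⟩ := exists_numberField_injective hN hm
  obtain ⟨φ⟩ : Nonempty (K →+* ℂ) := inferInstance
  have e : K ≃+* φ.fieldRange := RingEquiv.ofBijective φ.rangeRestrictField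
    φ.rangeRestrictField_bijective
  exact ⟨φ.fieldRange, NumberField.of_ringEquiv _ _ e,
    e.toRatAlgEquiv.toLinearEquiv.finrank_eq.symm.trans hK,
    (MulEquiv.toAdditive (classGroupEquiv e)).toAddMonoidHom.comp g,
    (MulEquiv.toAdditive (classGroupEquiv e)).injective.comp hg⟩

theorem exists_subfield_card_gt {N m : ℕ} (hN : 1 ≤ N) (hm : m ≠ 0) (n : ℕ) :
    ∃ K : Subfield ℂ, (NumberField K ∧ Module.finrank ℚ K = N + 1 ∧
      ∃ g : (Fin ((N + 1) / 2 + 1) → ZMod m) →+ Additive (ClassGroup (𝓞 K)),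
        Function.Injective g) ∧ n < Nat.card (ClassGroup (𝓞 K)) := by
  obtain ⟨K, hK, hrank, g, hg⟩ := exists_subfield_injective hN (m := m * (n + 1)) (by positivity)
  refine ⟨K, ⟨hK, hrank, g.comp ((zmodMulHom m (n + 1)).compLeft _),
    hg.comp ((zmodMulHom_injective m n.succ_ne_zero).comp_left)⟩, ?_⟩
  have h1 := Nat.card_le_card_of_injective (fun z : ZMod (m * (n + 1)) =>
    Additive.toMul (g fun _ => z)) fun x y hxy => congrFun (hg hxy) 0
  rw [Nat.card_zmod] at h1
  exact (Nat.le_mul_of_pos_left (n + 1) (Nat.pos_of_ne_zero hm)).trans h1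

end Fields

/-- Let `m > 1` and `d > 1`. There exist infinitely many isomorphism classes
of number fields `k` of degree `d` with `rank_m Cl(k) ≥ ⌊d/2⌋ + 1`. -/
theorem nakano_rank_bound (m d : ℕ) (hm : 1 < m) (hd : 1 < d) :
    ∃ S : Set (Subfield ℂ), S.Infinite ∧
      -- the fields in `S` are pairwise non-isomorphic
      (∀ K ∈ S, ∀ L ∈ S, Nonempty (↥K ≃+* ↥L) → K = L) ∧
      ∀ K ∈ S, NumberField ↥K ∧ Module.finrank ℚ ↥K = d ∧
        ∃ f : (Fin (d / 2 + 1) → ZMod m) →+ Additive (ClassGroup (𝓞 ↥K)),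
          Function.Injective f := by
  obtain ⟨N, rfl⟩ : ∃ N, d = N + 1 := ⟨d - 1, by omega⟩
  let T : Set (Subfield ℂ) := {K | NumberField K ∧ Module.finrank ℚ K = N + 1 ∧
    ∃ g : (Fin ((N + 1) / 2 + 1) → ZMod m) →+ Additive (ClassGroup (𝓞 K)),
      Function.Injective g}
  let h : Subfield ℂ → ℕ := fun K => Nat.card (ClassGroup (𝓞 K))
  have hinf : (h '' T).Infinite := Set.infinite_of_forall_exists_gt fun n => by
    obtain ⟨K, hK, hn⟩ := exists_subfield_card_gt (N := N) (m := m) (by omega) (by omega) n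
    exact ⟨h K, ⟨K, hK, rfl⟩, hn⟩
  obtain ⟨S, hST, hS⟩ := Set.exists_subset_bijOn T h
  refine ⟨S, Set.Infinite.of_image h (hS.image_eq ▸ hinf), fun K hK L hL ⟨e⟩ => ?_,
    fun K hK => hST hK⟩
  exact hS.injOn hK hL (Nat.card_congr (classGroupEquiv e).toEquiv)
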